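/- arXiv:1705.05346 — 3 statements merged into one kernel-verified Lean document; each statement's English description precedes it below -/
import Mathlib

section
/- Let N and k be positive integers with k < N, and suppose that either k = 1 and p > 0, or k > 1 and 0 < p < (k+1)/(k−1).enThen there is no lower semicontinuous function u : ℝ^N_+ → ℝ with u(x) > 0 for every x ∈ ℝ^N_+ which is a viscosity supersolution of P⁺_k(D²u) + u^p = 0 in ℝ^N_+. -/
open scoped BigOperators

/-- The eigenvalues of a symmetric real matrix, listed in nondecreasing order with
multiplicity (junk value `0` if the matrix is not Hermitian). -/
noncomputable def sortedEig {n : ℕ} (A : Matrix (Fin n) (Fin n) ℝ) : Fin n → ℝ :=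
  if h : A.IsHermitian then h.eigenvalues ∘ Tuple.sort h.eigenvalues else 0

/-- `P⁻_k(A)`: the sum of the `k` smallest eigenvalues of `A`. -/
noncomputable def Pminus {n : ℕ} (k : ℕ) (A : Matrix (Fin n) (Fin n) ℝ) : ℝ :=
  ∑ i : Fin n, if (i : ℕ) < k then sortedEig A i else 0

/-- `P⁺_k(A)`: the sum of the `k` largest eigenvalues of `A`. -/
noncomputable def Pplus {n : ℕ} (k : ℕ) (A : Matrix (Fin n) (Fin n) ℝ) : ℝ :=
  ∑ i : Fin n, if n - k ≤ (i : ℕ) then sortedEig A i else 0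

/-- The Hessian matrix `D²u(x)` of `u : ℝ^N → ℝ` at `x`. -/
noncomputable def hessianMatrix {N : ℕ} (u : EuclideanSpace ℝ (Fin N) → ℝ)
    (x : EuclideanSpace ℝ (Fin N)) : Matrix (Fin N) (Fin N) ℝ :=
  fun i j => iteratedFDeriv ℝ 2 u x ![EuclideanSpace.single i 1, EuclideanSpace.single j 1]

/-- `u` is a viscosity supersolution of `F(D²u) + g(u) = 0` in `Ω`. -/
def IsViscositySupersolution {N : ℕ} (F : Matrix (Fin N) (Fin N) ℝ → ℝ) (g : ℝ → ℝ)
    (Ω : Set (EuclideanSpace ℝ (Fin N))) (u : EuclideanSpace ℝ (Fin N) → ℝ) : Prop :=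
  ∀ x₀ ∈ Ω, ∀ φ : EuclideanSpace ℝ (Fin N) → ℝ, ContDiff ℝ 2 φ →
    IsLocalMinOn (fun x => u x - φ x) Ω x₀ →
      F (hessianMatrix φ x₀) + g (u x₀) ≤ 0

/-- `u` is a viscosity subsolution of `F(D²u) + g(u) = 0` in `Ω`. -/
def IsViscositySubsolution {N : ℕ} (F : Matrix (Fin N) (Fin N) ℝ → ℝ) (g : ℝ → ℝ)
    (Ω : Set (EuclideanSpace ℝ (Fin N))) (u : EuclideanSpace ℝ (Fin N) → ℝ) : Prop :=
  ∀ x₀ ∈ Ω, ∀ φ : EuclideanSpace ℝ (Fin N) → ℝ, ContDiff ℝ 2 φ →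
    IsLocalMaxOn (fun x => u x - φ x) Ω x₀ →
      0 ≤ F (hessianMatrix φ x₀) + g (u x₀)

/-- `u` is a viscosity solution of `F(D²u) + g(u) = 0` in `Ω`. -/
def IsViscositySolution {N : ℕ} (F : Matrix (Fin N) (Fin N) ℝ → ℝ) (g : ℝ → ℝ)
    (Ω : Set (EuclideanSpace ℝ (Fin N))) (u : EuclideanSpace ℝ (Fin N) → ℝ) : Prop :=
  IsViscositySubsolution F g Ω u ∧ IsViscositySupersolution F g Ω u

open Finset Set Filter Topology

theorem kyfan_aux {n : ℕ} (k : ℕ) (hk : 0 < k) (hkn : k ≤ n) (l : Fin n → ℝ) (hl : Monotone l)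
    (b : Fin n → ℝ) (h0 : ∀ j, 0 ≤ b j) (h1 : ∀ j, b j ≤ 1) (hs : ∑ j, b j = k) :
    ∑ j, b j * l j ≤ ∑ i : Fin n, if n - k ≤ (i : ℕ) then l i else 0 := by
  set μ := l ⟨n - k, by omega⟩ with hμ
  have hcard : ∑ i : Fin n, (if n - k ≤ (i : ℕ) then (1 : ℝ) else 0) = k := by
    rw [Fin.sum_univ_eq_sum_range (fun i => if n - k ≤ i then (1 : ℝ) else 0) n,
      Finset.sum_ite, Finset.sum_const_zero, add_zero, Finset.sum_const, nsmul_eq_mul, mul_one]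
    have : (Finset.range n).filter (fun i => n - k ≤ i) = Finset.Ico (n - k) n := by
      ext i; simp; omega
    rw [this, Nat.card_Ico]
    congr 1; omega
  have h : ∀ j : Fin n, b j * l j - b j * μ ≤
      (if n - k ≤ (j : ℕ) then l j else 0) - (if n - k ≤ (j : ℕ) then (1 : ℝ) else 0) * μ := by
    intro j
    split_ifs with hj
    · have : μ ≤ l j := hl (by simpa [Fin.le_def] using hj)
      nlinarith [h0 j, h1 j]
    · have : l j ≤ μ := hl (by simp [Fin.le_def]; omega)
      nlinarith [h0 j, h1 j]
  have := Finset.sum_le_sum (fun j (_ : j ∈ Finset.univ) => h j)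
  rw [Finset.sum_sub_distrib, Finset.sum_sub_distrib, ← Finset.sum_mul, ← Finset.sum_mul,
    hs, hcard] at this
  linarith

theorem kyfan {n : ℕ} (k : ℕ) (hk : 0 < k) (hkn : k ≤ n) (A : Matrix (Fin n) (Fin n) ℝ)
    (hA : A.IsHermitian) (S : Finset (Fin n)) (hS : S.card = k) :
    ∑ i ∈ S, A i i ≤ Pplus k A := by
  unfold Pplus sortedEig
  rw [dif_pos hA]
  set U : Matrix (Fin n) (Fin n) ℝ := (hA.eigenvectorUnitary : Matrix (Fin n) (Fin n) ℝ) with hU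
  have hdiag : ∀ i, A i i = ∑ j, (U i j) ^ 2 * hA.eigenvalues j := by
    intro i
    have := hA.spectral_theorem
    conv_lhs => rw [this]
    simp [Unitary.conjStarAlgAut_apply, Matrix.mul_apply, Matrix.diagonal_apply]
    refine Finset.sum_congr rfl fun j _ => ?_
    have hUj : U i j = (hA.eigenvectorBasis j).ofLp i := hA.eigenvectorUnitary_apply i j
    rw [hUj]; ring
  have hrow : ∀ i, ∑ j, (U i j) ^ 2 = 1 := by
    intro i
    have h := Unitary.coe_mul_star_self hA.eigenvectorUnitary
    have := congrFun (congrFun h i) i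
    simpa [Matrix.mul_apply, ← hU, sq] using this
  have hcol : ∀ j, ∑ i, (U i j) ^ 2 = 1 := by
    intro j
    have h := Unitary.coe_star_mul_self hA.eigenvectorUnitary
    have := congrFun (congrFun h j) j
    simpa [Matrix.mul_apply, ← hU, sq] using this
  set σ := Tuple.sort hA.eigenvalues
  have key := kyfan_aux k hk hkn (hA.eigenvalues ∘ σ) (Tuple.monotone_sort _)
    (fun j => ∑ i ∈ S, (U i (σ j)) ^ 2) (fun j => Finset.sum_nonneg fun _ _ => sq_nonneg _)
    (fun j => by
      rw [← hcol (σ j)]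
      exact Finset.sum_le_sum_of_subset_of_nonneg (Finset.subset_univ _)
        fun _ _ _ => sq_nonneg _)
    (by
      rw [Finset.sum_comm, ← hS, Finset.card_eq_sum_ones, Nat.cast_sum]
      refine Finset.sum_congr rfl fun i _ => ?_
      rw [Equiv.sum_comp σ (fun j => (U i j) ^ 2), hrow]; simp)
  refine le_trans (le_of_eq ?_) key
  simp_rw [Function.comp_apply]
  rw [Equiv.sum_comp σ (fun j => (∑ i ∈ S, (U i j) ^ 2) * hA.eigenvalues j)]
  simp_rw [Finset.sum_mul]
  rw [Finset.sum_comm]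
  exact Finset.sum_congr rfl fun i _ => hdiag i

theorem hess_herm {N : ℕ} (φ : EuclideanSpace ℝ (Fin N) → ℝ) (hφ : ContDiff ℝ 2 φ)
    (x : EuclideanSpace ℝ (Fin N)) : (hessianMatrix φ x).IsHermitian := by
  ext i j
  simp only [Matrix.conjTranspose_apply, hessianMatrix, star_trivial, iteratedFDeriv_two_apply]
  simp
  have : IsSymmSndFDerivAt ℝ φ x := hφ.contDiffAt.isSymmSndFDerivAt (by simp)
  exact this _ _

theorem hess_diag {N : ℕ} (φ : EuclideanSpace ℝ (Fin N) → ℝ) (hφ : ContDiff ℝ 2 φ)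
    (x : EuclideanSpace ℝ (Fin N)) (i : Fin N) (g' : ℝ → ℝ) (g'' : ℝ)
    (h1 : ∀ s : ℝ, HasDerivAt (fun s : ℝ => φ (x + s • EuclideanSpace.single i 1)) (g' s) s)
    (h2 : HasDerivAt g' g'' 0) : hessianMatrix φ x i i = g'' := by
  simp only [hessianMatrix, iteratedFDeriv_two_apply]
  simp
  set e : EuclideanSpace ℝ (Fin N) := EuclideanSpace.single i 1
  have hline : ∀ s : ℝ, HasDerivAt (fun s : ℝ => x + s • e) e s := by
    intro s
    simpa using ((hasDerivAt_id s).smul_const e).const_add x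
  have hg : ∀ s : ℝ, g' s = fderiv ℝ φ (x + s • e) e := by
    intro s
    have hd : HasFDerivAt φ (fderiv ℝ φ (x + s • e)) (x + s • e) :=
      (hφ.differentiable (by norm_num) _).hasFDerivAt
    exact (h1 s).unique (hd.comp_hasDerivAt s (hline s))
  have hd2 : DifferentiableAt ℝ (fderiv ℝ φ) (x + (0 : ℝ) • e) :=
    ((hφ.fderiv_right (m := 1) (by norm_num)).differentiable (by norm_num)) _
  have h3 := (hd2.hasFDerivAt.comp_hasDerivAt (0:ℝ) (hline 0))
  have h4 : HasDerivAt (fun s : ℝ => fderiv ℝ φ (x + s • e) e)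
      (fderiv ℝ (fderiv ℝ φ) (x + (0:ℝ) • e) e e) 0 := by
    have := h3.clm_apply (hasDerivAt_const (0:ℝ) e)
    simpa using this
  have h5 : g' = (fun s : ℝ => fderiv ℝ φ (x + s • e) e) := funext hg
  rw [h5] at h2
  have := h4.unique h2
  simpa using this

/-- squared norm of the coordinates in `S` -/
noncomputable def auxQ {N : ℕ} (S : Finset (Fin N)) (x : EuclideanSpace ℝ (Fin N)) : ℝ :=
  ∑ i ∈ S, (x i) ^ 2

/-- squared distance to `e` of the coordinates outside `S` -/
noncomputable def auxY {N : ℕ} (S : Finset (Fin N)) (e x : EuclideanSpace ℝ (Fin N)) : ℝ :=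
  ∑ i ∈ Sᶜ, (x i - e i) ^ 2

/-- the barrier -/
noncomputable def auxF {N : ℕ} (S : Finset (Fin N)) (e : EuclideanSpace ℝ (Fin N))
    (β ρ A ε : ℝ) (x : EuclideanSpace ℝ (Fin N)) : ℝ :=
  (1 + auxQ S x / ρ) ^ (-β) - A * auxY S e x - ε

theorem auxQ_nonneg {N : ℕ} (S : Finset (Fin N)) (x : EuclideanSpace ℝ (Fin N)) :
    0 ≤ auxQ S x := Finset.sum_nonneg fun _ _ => sq_nonneg _

theorem auxY_nonneg {N : ℕ} (S : Finset (Fin N)) (e x : EuclideanSpace ℝ (Fin N)) :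
    0 ≤ auxY S e x := Finset.sum_nonneg fun _ _ => sq_nonneg _

theorem auxQ_contDiff {N : ℕ} (S : Finset (Fin N)) : ContDiff ℝ 2 (auxQ S) := by
  unfold auxQ
  fun_prop

theorem auxY_contDiff {N : ℕ} (S : Finset (Fin N)) (e : EuclideanSpace ℝ (Fin N)) :
    ContDiff ℝ 2 (auxY S e) := by
  unfold auxY
  fun_prop

theorem auxF_contDiff {N : ℕ} (S : Finset (Fin N)) (e : EuclideanSpace ℝ (Fin N))
    (β ρ A ε : ℝ) (hρ : 0 < ρ) : ContDiff ℝ 2 (auxF S e β ρ A ε) := by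
  unfold auxF
  have h1 := auxQ_contDiff S
  have h2 := auxY_contDiff S e
  have h3 : ContDiff ℝ 2 (fun x => 1 + auxQ S x / ρ) := by fun_prop
  have h4 : ContDiff ℝ 2 (fun x => (1 + auxQ S x / ρ) ^ (-β)) :=
    h3.rpow_const_of_ne fun x => by
      have := div_nonneg (auxQ_nonneg S x) hρ.le
      positivity
  fun_prop

theorem auxQ_line {N : ℕ} (S : Finset (Fin N)) (x : EuclideanSpace ℝ (Fin N)) (i : Fin N)
    (hi : i ∈ S) (s : ℝ) :
    auxQ S (x + s • EuclideanSpace.single i 1) = auxQ S x + (2 * x i * s + s ^ 2) := by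
  unfold auxQ
  rw [← Finset.add_sum_erase S _ hi, ← Finset.add_sum_erase S _ hi]
  have : ∑ j ∈ S.erase i, ((x + s • EuclideanSpace.single i (1:ℝ)) j) ^ 2
      = ∑ j ∈ S.erase i, (x j) ^ 2 := by
    refine Finset.sum_congr rfl fun j hj => ?_
    have : j ≠ i := Finset.ne_of_mem_erase hj
    simp [this]
  rw [this]
  simp
  ring

theorem auxY_line {N : ℕ} (S : Finset (Fin N)) (e x : EuclideanSpace ℝ (Fin N)) (i : Fin N)
    (hi : i ∈ S) (s : ℝ) :
    auxY S e (x + s • EuclideanSpace.single i 1) = auxY S e x := by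
  unfold auxY
  refine Finset.sum_congr rfl fun j hj => ?_
  have : j ≠ i := by rintro rfl; simp at hj; exact hj hi
  simp [this]

theorem auxF_hess {N : ℕ} (S : Finset (Fin N)) (e : EuclideanSpace ℝ (Fin N))
    (β ρ A ε c : ℝ) (hρ : 0 < ρ) (x : EuclideanSpace ℝ (Fin N)) (i : Fin N) (hi : i ∈ S) :
    hessianMatrix (fun z => c * auxF S e β ρ A ε z) x i i
      = c * (-β * (-β - 1) * (1 + auxQ S x / ρ) ^ (-β - 1 - 1) * (2 * x i / ρ) ^ 2
          - β * (1 + auxQ S x / ρ) ^ (-β - 1) * (2 / ρ)) := by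
  set q : ℝ → ℝ := fun s => 1 + (auxQ S x + (2 * x i * s + s ^ 2)) / ρ with hq
  have hqpos : ∀ s, 0 < q s := by
    intro s
    have := div_nonneg (auxQ_nonneg S (x + s • EuclideanSpace.single i 1)) hρ.le
    rw [auxQ_line S x i hi] at this
    simp only [hq]; linarith
  have hqd : ∀ s, HasDerivAt q ((2 * x i + 2 * s) / ρ) s := by
    intro s
    have h1 : HasDerivAt (fun s : ℝ => 2 * x i * s + s ^ 2) (2 * x i + 2 * s) s := by
      have := ((hasDerivAt_id s).const_mul (2 * x i)).add ((hasDerivAt_id s).pow 2)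
      exact this.congr_deriv (by simp)
    exact ((h1.const_add _).div_const ρ).const_add 1
  refine hess_diag _ (contDiff_const.mul (auxF_contDiff S e β ρ A ε hρ)) x i
    (fun s => c * ((2 * x i + 2 * s) / ρ * (-β) * (q s) ^ (-β - 1))) _ ?_ ?_
  · intro s
    have := (((hqd s).rpow_const (p := -β) (Or.inl (hqpos s).ne')).sub_const
      (A * auxY S e x)).sub_const ε |>.const_mul c
    refine this.congr_of_eventuallyEq (Eventually.of_forall fun s => ?_)
    simp only [auxF, auxQ_line S x i hi, auxY_line S e x i hi, hq]
  · have h1 : HasDerivAt (fun s : ℝ => (2 * x i + 2 * s) / ρ * (-β)) (2 / ρ * (-β)) 0 := by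
      have := ((((hasDerivAt_id (0:ℝ)).const_mul 2).const_add (2 * x i)).div_const ρ).mul_const (-β)
      simpa using this
    have h2 := (hqd 0).rpow_const (p := -β - 1) (Or.inl (hqpos 0).ne')
    have := (h1.mul h2).const_mul c
    refine this.congr_deriv ?_
    have hq0 : q 0 = 1 + auxQ S x / ρ := by simp [hq]
    rw [hq0]
    ring

theorem auxF_trace {N : ℕ} (k : ℕ) (hk : 0 < k) (hkN : k ≤ N) (S : Finset (Fin N))
    (hS : S.card = k) (e : EuclideanSpace ℝ (Fin N))
    (β ρ A ε c : ℝ) (hρ : 0 < ρ) (x : EuclideanSpace ℝ (Fin N)) :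
    c * (2 * β / ρ * (1 + auxQ S x / ρ) ^ (-β - 2) *
      ((2 * β + 2 - k) * (auxQ S x / ρ) - k)) ≤
    Pplus k (hessianMatrix (fun z => c * auxF S e β ρ A ε z) x) := by
  refine le_trans (le_of_eq ?_) (kyfan k hk hkN _ (hess_herm _
    (contDiff_const.mul (auxF_contDiff S e β ρ A ε hρ)) x) S hS)
  rw [Finset.sum_congr rfl fun i hi => auxF_hess S e β ρ A ε c hρ x i hi, ← Finset.mul_sum,
    Finset.sum_sub_distrib, ← Finset.mul_sum, Finset.sum_const, hS]
  have h1 : ∑ i ∈ S, (2 * x i / ρ) ^ 2 = 4 / ρ ^ 2 * auxQ S x := by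
    unfold auxQ; rw [Finset.mul_sum]
    refine Finset.sum_congr rfl fun i _ => ?_
    ring
  have hpos : 0 < 1 + auxQ S x / ρ := by
    have := div_nonneg (auxQ_nonneg S x) hρ.le
    linarith
  have h2 : (1 + auxQ S x / ρ) ^ (-β - 1) =
      (1 + auxQ S x / ρ) ^ (-β - 2) * (1 + auxQ S x / ρ) := by
    rw [← Real.rpow_add_one hpos.ne']; congr 1; ring
  rw [h1, h2, show -β - 1 - 1 = -β - 2 by ring, nsmul_eq_mul]
  field_simp
  ring

theorem aux_norm {N : ℕ} (S : Finset (Fin N)) (e x : EuclideanSpace ℝ (Fin N))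
    (he : ∀ i ∈ S, e i = 0) : ‖x - e‖ ^ 2 = auxQ S x + auxY S e x := by
  rw [EuclideanSpace.norm_sq_eq, ← Finset.sum_add_sum_compl S]
  unfold auxQ auxY
  congr 1
  · refine Finset.sum_congr rfl fun i hi => ?_
    simp [he i hi]
  · simp

theorem aux_compact {N : ℕ} (S : Finset (Fin N)) (e : EuclideanSpace ℝ (Fin N))
    (he : ∀ i ∈ S, e i = 0) (K : Set (EuclideanSpace ℝ (Fin N))) (hK : IsClosed K) (a b : ℝ)
    (h : ∀ x ∈ K, auxQ S x ≤ a ∧ auxY S e x ≤ b) : IsCompact K := by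
  refine Metric.isCompact_of_isClosed_isBounded hK
    ((Metric.isBounded_closedBall (x := e) (r := √(a + b))).subset fun x hx => ?_)
  rw [Metric.mem_closedBall, dist_eq_norm]
  apply Real.le_sqrt_of_sq_le
  rw [aux_norm S e x he]
  linarith [h x hx]

theorem aux_mem {N : ℕ} (S : Finset (Fin N)) (e x : EuclideanSpace ℝ (Fin N)) (l : Fin N)
    (hl : l ∉ S) (hel : e l = 1) (hY : auxY S e x ≤ 1 / 4) : 0 < x l := by
  have h : (x l - e l) ^ 2 ≤ auxY S e x := by
    unfold auxY
    exact Finset.single_le_sum (f := fun i => (x i - e i) ^ 2)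
      (fun _ _ => sq_nonneg _) (by simpa using hl)
  rw [hel] at h
  nlinarith

theorem aux_touch {N : ℕ} (k : ℕ) (hk : 0 < k) (hkN : k ≤ N) (p : ℝ) (S : Finset (Fin N))
    (hS : S.card = k) (e : EuclideanSpace ℝ (Fin N)) (he : ∀ i ∈ S, e i = 0)
    (l : Fin N) (hl : l ∉ S) (hel : e l = 1) (u : EuclideanSpace ℝ (Fin N) → ℝ)
    (hlsc : LowerSemicontinuousOn u {x | 0 < x l}) (hpos : ∀ x ∈ {x | 0 < x l}, 0 < u x)
    (hu : IsViscositySupersolution (Pplus k) (fun t => t ^ p) {x | 0 < x l} u)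
    (β : ℝ) (hβ : 0 < β) (hβk : 0 < 2 * β + 2 - k)
    (ρ A ε : ℝ) (hρ : 1 ≤ ρ) (hA : 4 ≤ A) (hε : 0 < ε) (hε1 : ε < 1) :
    ∃ c : ℝ, ∃ x : EuclideanSpace ℝ (Fin N), 0 < c ∧ 0 < auxF S e β ρ A ε x ∧
      u x = c * auxF S e β ρ A ε x ∧ (∀ z ∈ {x | 0 < x l}, c * auxF S e β ρ A ε z ≤ u z) ∧
      auxQ S x / ρ ≤ k / (2 * β + 2 - k) ∧ auxY S e x ≤ 1 / 4 ∧
      (u x) ^ p ≤ 2 * β * k / ρ * c := by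
  have hρ0 : 0 < ρ := by linarith
  set f := auxF S e β ρ A ε with hf
  have hfc : Continuous f := (auxF_contDiff S e β ρ A ε hρ0).continuous
  have hw0 : ∀ x, 0 ≤ auxQ S x / ρ := fun x => div_nonneg (auxQ_nonneg S x) hρ0.le
  have hw1 : ∀ x, (1 + auxQ S x / ρ) ^ (-β) ≤ 1 := fun x =>
    Real.rpow_le_one_of_one_le_of_nonpos (by linarith [hw0 x]) (by linarith)
  set K : Set (EuclideanSpace ℝ (Fin N)) := {x | 0 ≤ f x} with hKdef
  have hKY : ∀ x ∈ K, auxY S e x ≤ 1 / 4 := by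
    intro x hx
    have h1 : 0 ≤ (1 + auxQ S x / ρ) ^ (-β) - A * auxY S e x - ε := hx
    nlinarith [hw1 x, auxY_nonneg S e x]
  have hKΩ : K ⊆ {x | 0 < x l} := fun x hx => aux_mem S e x l hl hel (hKY x hx)
  have hKQ : ∀ x ∈ K, auxQ S x ≤ ρ * ε ^ (-β⁻¹) := by
    intro x hx
    have h1 : 0 ≤ (1 + auxQ S x / ρ) ^ (-β) - A * auxY S e x - ε := hx
    have h2 : ε ≤ (1 + auxQ S x / ρ) ^ (-β) := by nlinarith [auxY_nonneg S e x]
    have h3 := Real.rpow_le_rpow_of_nonpos hε h2 (z := -β⁻¹) (by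
      have := inv_pos.mpr hβ; linarith)
    rw [← Real.rpow_mul (by linarith [hw0 x])] at h3
    rw [show -β * -β⁻¹ = 1 by field_simp, Real.rpow_one] at h3
    have h4 : auxQ S x / ρ ≤ ε ^ (-β⁻¹) := by linarith
    rw [div_le_iff₀ hρ0] at h4
    linarith
  have hKc : IsCompact K := aux_compact S e he K (isClosed_le continuous_const hfc) _ _
    fun x hx => ⟨hKQ x hx, hKY x hx⟩
  have hfe : f e = 1 - ε := by
    have h1 : auxQ S e = 0 := Finset.sum_eq_zero fun i hi => by simp [he i hi]
    have h2 : auxY S e e = 0 := Finset.sum_eq_zero fun i hi => by simp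
    simp [hf, auxF, h1, h2]
  have heK : e ∈ K := by simp only [hKdef, Set.mem_ofPred_eq, hfe]; linarith
  have husc : UpperSemicontinuousOn (fun x => f x / u x) K := by
    intro x hx a ha
    have hux := hpos x (hKΩ hx)
    have ha0 : 0 < a := lt_of_le_of_lt (div_nonneg hx hux.le) ha
    rw [div_lt_iff₀ hux] at ha
    have h1 : f x / a < u x := by rw [div_lt_iff₀ ha0]; linarith
    obtain ⟨b, hb1, hb2⟩ := exists_between h1
    have h2 := (hlsc x (hKΩ hx) b hb2).filter_mono (nhdsWithin_mono x hKΩ)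
    have h3 : ∀ᶠ z in 𝓝[K] x, f z / a < b :=
      ((hfc.div_const a).continuousAt.eventually_lt_const hb1).filter_mono nhdsWithin_le_nhds
    filter_upwards [h2, h3, self_mem_nhdsWithin] with z hz1 hz2 hz3
    rw [div_lt_iff₀ (hpos z (hKΩ hz3))]
    have := hz2.trans hz1
    rw [div_lt_iff₀ ha0] at this
    linarith
  obtain ⟨x, hxK, hx⟩ := husc.exists_isMaxOn ⟨e, heK⟩ hKc
  have hux := hpos x (hKΩ hxK)
  have hM : 0 < f x / u x := by
    refine lt_of_lt_of_le (div_pos ?_ (hpos e (hKΩ heK))) (hx heK)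
    rw [hfe]; linarith
  have hfx : 0 < f x := by
    by_contra h
    push Not at h
    exact absurd hM (not_lt.mpr (div_nonpos_of_nonpos_of_nonneg h hux.le))
  set c := u x / f x with hc
  have hcpos : 0 < c := div_pos hux hfx
  have huxc : u x = c * f x := by rw [hc]; field_simp
  have hall : ∀ z ∈ {x : EuclideanSpace ℝ (Fin N) | 0 < x l}, c * f z ≤ u z := by
    intro z hz
    have huz := hpos z hz
    by_cases hfz : 0 ≤ f z
    · have h1 : f z / u z ≤ f x / u x := hx (show z ∈ K from hfz)
      rw [div_le_div_iff₀ huz hux] at h1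
      rw [hc, div_mul_eq_mul_div, div_le_iff₀ hfx]
      linarith
    · push Not at hfz
      nlinarith
  have hv := hu x (hKΩ hxK) (fun z => c * f z)
    (contDiff_const.mul (auxF_contDiff S e β ρ A ε hρ0)) (by
      have : IsMinOn (fun x => u x - c * f x) {x | 0 < x l} x := by
        intro z hz
        have := hall z hz
        simp only [Set.mem_ofPred_eq]
        linarith
      exact this.localize)
  have htr := auxF_trace k hk hkN S hS e β ρ A ε c hρ0 x
  have hv2 : c * (2 * β / ρ * (1 + auxQ S x / ρ) ^ (-β - 2) *
      ((2 * β + 2 - k) * (auxQ S x / ρ) - k)) + (u x) ^ p ≤ 0 := by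
    refine le_trans ?_ hv
    gcongr
  set t := auxQ S x / ρ with ht
  have ht0 : 0 ≤ t := hw0 x
  set W := (1 + t) ^ (-β - 2) with hW
  have hWpos : 0 < W := Real.rpow_pos_of_pos (by linarith) _
  have hW1 : W ≤ 1 := Real.rpow_le_one_of_one_le_of_nonpos (by linarith) (by linarith)
  have hup : 0 < (u x) ^ p := Real.rpow_pos_of_pos hux _
  set D := c * (2 * β / ρ) with hD
  have hDpos : 0 < D := by positivity
  have hv3 : D * W * ((2 * β + 2 - k) * t - k) + (u x) ^ p ≤ 0 := by
    calc _ = c * (2 * β / ρ * W * ((2 * β + 2 - k) * t - k)) + (u x) ^ p := by rw [hD]; ring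
      _ ≤ 0 := hv2
  have hDW : 0 < D * W := mul_pos hDpos hWpos
  have hk0 : (0:ℝ) < k := by exact_mod_cast hk
  refine ⟨c, x, hcpos, hfx, huxc, hall, ?_, hKY x hxK, ?_⟩
  · rw [le_div_iff₀ hβk]
    by_contra h
    push Not at h
    have : 0 < D * W * ((2 * β + 2 - k) * t - k) := mul_pos hDW (by linarith)
    linarith
  · have h1 : 0 ≤ D * W * ((2 * β + 2 - k) * t) := by positivity
    have h2 : D * W * k ≤ D * k := by
      have : D * W ≤ D * 1 := by gcongr
      nlinarith
    calc (u x) ^ p ≤ D * k := by nlinarith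
      _ = _ := by rw [hD]; ring

theorem aux_lower {N : ℕ} (k : ℕ) (hk : 0 < k) (hkN : k ≤ N) (p : ℝ) (S : Finset (Fin N))
    (hS : S.card = k) (e : EuclideanSpace ℝ (Fin N)) (he : ∀ i ∈ S, e i = 0)
    (l : Fin N) (hl : l ∉ S) (hel : e l = 1) (u : EuclideanSpace ℝ (Fin N) → ℝ)
    (hlsc : LowerSemicontinuousOn u {x | 0 < x l}) (hpos : ∀ x ∈ {x | 0 < x l}, 0 < u x)
    (hu : IsViscositySupersolution (Pplus k) (fun t => t ^ p) {x | 0 < x l} u)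
    (β : ℝ) (hβ : 0 < β) (hβk : 0 < 2 * β + 2 - k) :
    ∃ m : ℝ, 0 < m ∧ ∀ z : EuclideanSpace ℝ (Fin N), 0 < z l →
      m * ((1 + auxQ S z) ^ (-β) - 4 * auxY S e z) ≤ u z := by
  set T : ℝ := k / (2 * β + 2 - k) with hT
  have hT0 : 0 ≤ T := by positivity
  set K : Set (EuclideanSpace ℝ (Fin N)) := {x | auxQ S x ≤ T ∧ auxY S e x ≤ 1 / 4} with hK
  have hKc : IsCompact K := by
    refine aux_compact S e he K ?_ T (1 / 4) fun x hx => hx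
    exact (isClosed_le (auxQ_contDiff S).continuous continuous_const).inter
      (isClosed_le (auxY_contDiff S e).continuous continuous_const)
  have hKΩ : K ⊆ {x | 0 < x l} := fun x hx => aux_mem S e x l hl hel hx.2
  have heK : e ∈ K := by
    have h1 : auxQ S e = 0 := Finset.sum_eq_zero fun i hi => by simp [he i hi]
    have h2 : auxY S e e = 0 := Finset.sum_eq_zero fun i hi => by simp
    constructor
    · rw [h1]; exact hT0
    · rw [h2]; norm_num
  obtain ⟨x0, hx0, hmin⟩ := (hlsc.mono hKΩ).exists_isMinOn ⟨e, heK⟩ hKc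
  have hm := hpos x0 (hKΩ hx0)
  refine ⟨u x0, hm, fun z hz => ?_⟩
  have huz := hpos z hz
  refine le_of_forall_pos_le_add fun η hη => ?_
  -- choose ε small
  set ε : ℝ := min (1 / 2) (η / u x0) with hεdef
  have hε : 0 < ε := lt_min (by norm_num) (div_pos hη hm)
  have hε1 : ε < 1 := lt_of_le_of_lt (min_le_left _ _) (by norm_num)
  have hεη : u x0 * ε ≤ η := by
    have := min_le_right (1 / 2) (η / u x0)
    rw [← hεdef, le_div_iff₀ hm] at this
    linarith
  obtain ⟨c, x, hc, hfx, hux, hall, hQ, hY, -⟩ := aux_touch k hk hkN p S hS e he l hl hel u hlsc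
    hpos hu β hβ hβk 1 4 ε le_rfl le_rfl hε hε1
  rw [div_one] at hQ
  have hxm : u x0 ≤ u x := hmin (show x ∈ K from ⟨hQ, hY⟩)
  have hf1 : auxF S e β 1 4 ε x ≤ 1 := by
    unfold auxF
    have h1 : (1 + auxQ S x / 1) ^ (-β) ≤ 1 :=
      Real.rpow_le_one_of_one_le_of_nonpos (by linarith [auxQ_nonneg S x, div_one (auxQ S x)])
        (by linarith)
    linarith [auxY_nonneg S e x]
  have hcm : u x0 ≤ c := by nlinarith
  have hz1 := hall z hz
  unfold auxF at hz1
  rw [div_one] at hz1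
  set G := (1 + auxQ S z) ^ (-β) - 4 * auxY S e z with hG
  by_cases hGε : 0 ≤ G - ε
  · have : u x0 * (G - ε) ≤ c * (G - ε) := by gcongr
    nlinarith
  · push Not at hGε
    nlinarith

theorem aux_step {N : ℕ} (k : ℕ) (hk : 0 < k) (hkN : k ≤ N) (p : ℝ) (hp : 0 < p)
    (S : Finset (Fin N))
    (hS : S.card = k) (e : EuclideanSpace ℝ (Fin N)) (he : ∀ i ∈ S, e i = 0)
    (l : Fin N) (hl : l ∉ S) (hel : e l = 1) (u : EuclideanSpace ℝ (Fin N) → ℝ)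
    (hlsc : LowerSemicontinuousOn u {x | 0 < x l}) (hpos : ∀ x ∈ {x | 0 < x l}, 0 < u x)
    (hu : IsViscositySupersolution (Pplus k) (fun t => t ^ p) {x | 0 < x l} u)
    (β : ℝ) (hβ : 0 < β) (hβk : 0 < 2 * β + 2 - k) :
    ∃ m δ V : ℝ, 0 < m ∧ 0 < δ ∧ 0 < V ∧ ∀ ρ : ℝ, 1 ≤ ρ → ∃ c : ℝ, m ≤ ρ ^ β * c ∧ 0 < c ∧
      c ≤ V ∧ (c * δ) ^ p ≤ 2 * β * k / ρ * c := by
  obtain ⟨m, hm, hlow⟩ := aux_lower k hk hkN p S hS e he l hl hel u hlsc hpos hu β hβ hβk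
  set T : ℝ := k / (2 * β + 2 - k) with hT
  have hT0 : 0 ≤ T := by positivity
  set δ : ℝ := (1 + T) ^ (-β) / 3 with hδdef
  have hδ : 0 < δ := by
    have : 0 < (1 + T) ^ (-β) := Real.rpow_pos_of_pos (by linarith) _
    positivity
  have hδ1 : δ < 1 := by
    have : (1 + T) ^ (-β) ≤ 1 :=
      Real.rpow_le_one_of_one_le_of_nonpos (by linarith) (by linarith)
    linarith
  have heΩ : e ∈ {x : EuclideanSpace ℝ (Fin N) | 0 < x l} := by
    show 0 < e l
    rw [hel]; norm_num
  have hue := hpos e heΩ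
  set V := u e / (1 - δ) with hV
  have hVpos : 0 < V := div_pos hue (by linarith)
  refine ⟨m, δ, V, hm, hδ, hVpos, fun ρ hρ => ?_⟩
  have hρ0 : 0 < ρ := by linarith
  have hρβ : 1 ≤ ρ ^ β := Real.one_le_rpow hρ hβ.le
  have h2j : ∀ j : ℕ, (1:ℝ) ≤ 2 ^ j := fun j => one_le_pow₀ (by norm_num)
  have hAj : ∀ j : ℕ, 4 * ρ ^ β ≤ 4 * ρ ^ β * 2 ^ j := fun j => by nlinarith [h2j j]
  have hAj4 : ∀ j : ℕ, 4 ≤ 4 * ρ ^ β * 2 ^ j := fun j => by linarith [hAj j]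
  choose c x hc hfx hux hall hQ hY hup using fun j : ℕ =>
    aux_touch k hk hkN p S hS e he l hl hel u hlsc
      hpos hu β hβ hβk ρ (4 * ρ ^ β * 2 ^ j) δ hρ (hAj4 j) hδ hδ1
  have hxΩ : ∀ j, x j ∈ {x : EuclideanSpace ℝ (Fin N) | 0 < x l} := fun j =>
    aux_mem S e (x j) l hl hel (hY j)
  have hcV : ∀ j, c j ≤ V := by
    intro j
    have h := hall j e heΩ
    have h1 : auxQ S e = 0 := Finset.sum_eq_zero fun i hi => by simp [he i hi]
    have h2 : auxY S e e = 0 := Finset.sum_eq_zero fun i hi => by simp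
    have hfe : auxF S e β ρ (4 * ρ ^ β * 2 ^ j) δ e = 1 - δ := by simp [auxF, h1, h2]
    rw [hfe] at h
    rw [hV, le_div_iff₀ (by linarith)]
    exact h
  have hcm : ∀ j, m ≤ ρ ^ β * c j := by
    intro j
    have h1 := hlow (x j) (hxΩ j)
    have hQ0 := auxQ_nonneg S (x j)
    have hY0 := auxY_nonneg S e (x j)
    have h2 : (1 + auxQ S (x j) / ρ) ^ (-β) ≤ (1 + auxQ S (x j)) ^ (-β) * ρ ^ β := by
      have h3 : (1 + auxQ S (x j)) / ρ ≤ 1 + auxQ S (x j) / ρ := by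
        rw [add_div]
        have : 1 / ρ ≤ 1 := by rw [div_le_one hρ0]; exact hρ
        linarith
      have h4 := Real.rpow_le_rpow_of_nonpos (by positivity) h3 (z := -β) (by linarith)
      rw [Real.div_rpow (by linarith) hρ0.le, Real.rpow_neg hρ0.le, div_inv_eq_mul] at h4
      exact h4
    have h3 : auxF S e β ρ (4 * ρ ^ β * 2 ^ j) δ (x j) ≤
        ρ ^ β * ((1 + auxQ S (x j)) ^ (-β) - 4 * auxY S e (x j)) := by
      unfold auxF
      have := mul_le_mul_of_nonneg_right (hAj j) hY0
      linarith
    have h4 := hfx j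
    have h5 := hux j
    set F := auxF S e β ρ (4 * ρ ^ β * 2 ^ j) δ (x j)
    set G := (1 + auxQ S (x j)) ^ (-β) - 4 * auxY S e (x j)
    have h6 : m * F ≤ (ρ ^ β * c j) * F := by
      calc m * F ≤ m * (ρ ^ β * G) := by gcongr
        _ = ρ ^ β * (m * G) := by ring
        _ ≤ ρ ^ β * u (x j) := by gcongr
        _ = _ := by rw [h5]; ring
    exact le_of_mul_le_mul_right h6 h4
  obtain ⟨j, hj⟩ : ∃ j, c (j + 1) ≤ (1 + δ / 2) * c j := by
    by_contra hcon
    push Not at hcon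
    have hgrow : ∀ j, (1 + δ / 2) ^ j * c 0 ≤ c j := by
      intro j
      induction j with
      | zero => simp
      | succ j ih =>
        calc _ = (1 + δ / 2) * ((1 + δ / 2) ^ j * c 0) := by ring
          _ ≤ (1 + δ / 2) * c j := by gcongr
          _ ≤ _ := (hcon j).le
    obtain ⟨n, hn⟩ := pow_unbounded_of_one_lt (V / c 0) (by linarith : 1 < 1 + δ / 2)
    rw [div_lt_iff₀ (hc 0)] at hn
    linarith [hgrow n, hcV n]
  refine ⟨c (j + 1), hcm _, hc _, hcV _, le_trans ?_ (hup (j + 1))⟩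
  have h1 := hall j (x (j + 1)) (hxΩ _)
  have h2 := hux (j + 1)
  have hQ0 := auxQ_nonneg S (x (j + 1))
  have hY0 := auxY_nonneg S e (x (j + 1))
  have hcj := hc j
  have hcj1 := hc (j + 1)
  have hF := hfx (j + 1)
  have hw : 3 * δ ≤ (1 + auxQ S (x (j + 1)) / ρ) ^ (-β) := by
    have := Real.rpow_le_rpow_of_nonpos (x := 1 + auxQ S (x (j + 1)) / ρ) (y := 1 + T)
      (by positivity) (by linarith [hQ (j + 1)]) (z := -β) (by linarith)
    rw [hδdef]; linarith
  have hw1 : (1 + auxQ S (x (j + 1)) / ρ) ^ (-β) ≤ 1 :=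
    Real.rpow_le_one_of_one_le_of_nonpos (by
      have := div_nonneg hQ0 hρ0.le
      linarith) (by linarith)
  have hFδ : δ ≤ auxF S e β ρ (4 * ρ ^ β * 2 ^ (j + 1)) δ (x (j + 1)) := by
    rw [h2] at h1
    unfold auxF at h1 hF ⊢
    rw [pow_succ] at h1 hF ⊢
    set w := (1 + auxQ S (x (j + 1)) / ρ) ^ (-β)
    set B := 4 * ρ ^ β * 2 ^ j * auxY S e (x (j + 1)) with hB
    have hB0 : 0 ≤ B := by positivity
    have e1 : 4 * ρ ^ β * (2 ^ j * 2) * auxY S e (x (j + 1)) = 2 * B := by rw [hB]; ring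
    rw [e1] at h1 hF ⊢
    -- c j (w - B - δ) ≤ c (j+1) (w - 2B - δ) ≤ (1 + δ/2) c j (w - 2B - δ)
    have h3 : c j * (w - B - δ) ≤ c j * ((1 + δ / 2) * (w - 2 * B - δ)) := by
      calc _ ≤ _ := h1
        _ ≤ ((1 + δ / 2) * c j) * (w - 2 * B - δ) := by gcongr
        _ = _ := by ring
    have h4 := le_of_mul_le_mul_left h3 hcj
    have h5 : δ * (w - 2 * B - δ) ≤ δ * 1 := by gcongr; linarith
    linarith
  rw [h2]
  gcongr

theorem aux_main {N : ℕ} (k : ℕ) (hk : 0 < k) (hkN : k ≤ N) (p : ℝ) (hp : 0 < p)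
    (S : Finset (Fin N))
    (hS : S.card = k) (e : EuclideanSpace ℝ (Fin N)) (he : ∀ i ∈ S, e i = 0)
    (l : Fin N) (hl : l ∉ S) (hel : e l = 1) (u : EuclideanSpace ℝ (Fin N) → ℝ)
    (hlsc : LowerSemicontinuousOn u {x | 0 < x l}) (hpos : ∀ x ∈ {x | 0 < x l}, 0 < u x)
    (hu : IsViscositySupersolution (Pplus k) (fun t => t ^ p) {x | 0 < x l} u)
    (β : ℝ) (hβ : 0 < β) (hβk : 0 < 2 * β + 2 - k) (hβp : β * (p - 1) < 1) : False := by
  obtain ⟨m, δ, V, hm, hδ, hV, H⟩ :=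
    aux_step k hk hkN p hp S hS e he l hl hel u hlsc hpos hu β hβ hβk
  have hk0 : (0:ℝ) < k := by exact_mod_cast hk
  have hδp : 0 < δ ^ p := Real.rpow_pos_of_pos hδ _
  set C := 2 * β * k / δ ^ p with hC
  have hCpos : 0 < C := by positivity
  -- reduce to a bound on `c ^ (p - 1)`
  have H2 : ∀ ρ : ℝ, 1 ≤ ρ → ∃ c : ℝ, m ≤ ρ ^ β * c ∧ 0 < c ∧ c ≤ V ∧
      ρ * c ^ (p - 1) ≤ C := by
    intro ρ hρ
    have hρ0 : 0 < ρ := by linarith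
    obtain ⟨c, h1, h2, h3, h4⟩ := H ρ hρ
    refine ⟨c, h1, h2, h3, ?_⟩
    rw [Real.mul_rpow h2.le hδ.le] at h4
    rw [Real.rpow_sub_one h2.ne', hC, le_div_iff₀ hδp]
    rw [div_mul_eq_mul_div, le_div_iff₀ hρ0] at h4
    calc ρ * (c ^ p / c) * δ ^ p = (c ^ p * δ ^ p * ρ) / c := by ring
      _ ≤ (2 * β * k * c) / c := by gcongr
      _ = _ := by field_simp
  rcases le_total 1 p with hp1 | hp1
  · have hs : 0 < 1 - β * (p - 1) := by linarith
    have hmp : 0 < m ^ (p - 1) := Real.rpow_pos_of_pos hm _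
    have ht := tendsto_rpow_atTop hs
    obtain ⟨ρ, hρ1, hρ2⟩ := ((ht.eventually_gt_atTop (C / m ^ (p - 1))).and
      (eventually_ge_atTop 1)).exists
    have hρ0 : 0 < ρ := by linarith
    obtain ⟨c, h1, h2, -, h4⟩ := H2 ρ hρ2
    have h5 : m ^ (p - 1) ≤ ρ ^ (β * (p - 1)) * c ^ (p - 1) := by
      rw [Real.rpow_mul hρ0.le, ← Real.mul_rpow (by positivity) h2.le]
      exact Real.rpow_le_rpow hm.le h1 (by linarith)
    rw [div_lt_iff₀ hmp] at hρ1
    have h6 : ρ ^ (1 - β * (p - 1)) * ρ ^ (β * (p - 1)) = ρ := by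
      rw [← Real.rpow_add hρ0]; simp
    have h7 : ρ ^ (1 - β * (p - 1)) * m ^ (p - 1) ≤ ρ * c ^ (p - 1) := by
      calc _ ≤ ρ ^ (1 - β * (p - 1)) * (ρ ^ (β * (p - 1)) * c ^ (p - 1)) := by gcongr
        _ = _ := by rw [← mul_assoc, h6]
    linarith
  · have hVp : 0 < V ^ (p - 1) := Real.rpow_pos_of_pos hV _
    obtain ⟨c, -, h2, h3, h4⟩ := H2 (max 1 (2 * C / V ^ (p - 1))) (le_max_left _ _)
    have h5 : V ^ (p - 1) ≤ c ^ (p - 1) := Real.rpow_le_rpow_of_nonpos h2 h3 (by linarith)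
    have h6 : 2 * C / V ^ (p - 1) * V ^ (p - 1) ≤ C := by
      calc _ ≤ max 1 (2 * C / V ^ (p - 1)) * c ^ (p - 1) := by
            gcongr
            exact le_max_right _ _
        _ ≤ C := h4
    rw [div_mul_cancel₀ _ hVp.ne'] at h6
    linarith

theorem statement12 (N k : ℕ) (hk : 0 < k) (hkN : k < N) (p : ℝ)
    (hp : (k = 1 ∧ 0 < p) ∨ (1 < k ∧ 0 < p ∧ p < ((k : ℝ) + 1) / ((k : ℝ) - 1))) :
    ¬ ∃ u : EuclideanSpace ℝ (Fin N) → ℝ,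
      let lastIdx : Fin N := ⟨N - 1, by omega⟩
      let Ω : Set (EuclideanSpace ℝ (Fin N)) := {x | 0 < x lastIdx}
      LowerSemicontinuousOn u Ω ∧ (∀ x ∈ Ω, 0 < u x) ∧
        IsViscositySupersolution (Pplus k) (fun t => t ^ p) Ω u := by
  rintro ⟨u, hlsc, hpos, hu⟩
  have hk0 : (0:ℝ) < k := by exact_mod_cast hk
  obtain ⟨β, hβ, hβk, hβp⟩ : ∃ β : ℝ, 0 < β ∧ 0 < 2 * β + 2 - k ∧ β * (p - 1) < 1 := by
    rcases hp with ⟨rfl, hp⟩ | ⟨hk1, hp, hpk⟩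
    · refine ⟨1 / (p + 1), by positivity, ?_, ?_⟩
      · have : 0 < 1 / (p + 1) := by positivity
        push_cast; linarith
      · rw [div_mul_eq_mul_div, div_lt_one (by linarith)]; linarith
    · have hk1' : (1:ℝ) < k := by exact_mod_cast hk1
      refine ⟨((k:ℝ) - 1) / 2, by linarith, by linarith, ?_⟩
      rw [lt_div_iff₀ (by linarith)] at hpk
      linarith
  have hp0 : 0 < p := by rcases hp with h | h <;> [exact h.2; exact h.2.1]
  set S : Finset (Fin N) := Finset.univ.filter (fun i : Fin N => (i : ℕ) < k) with hSdef
  have hS : S.card = k := by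
    rw [hSdef, Fin.card_filter_val_lt]; omega
  set l : Fin N := ⟨N - 1, by omega⟩ with hldef
  have hl : l ∉ S := by simp [hSdef, hldef]; omega
  exact aux_main k hk hkN.le p hp0 S hS (EuclideanSpace.single l 1)
    (fun i hi => by
      have : i ≠ l := by rintro rfl; exact hl hi
      simp [this]) l hl (by simp) u hlsc hpos hu β hβ hβk hβp
end

section
/- Hadamard three circles theorem for P⁺_k: let N and k be positive integers with k ≤ N, let Ω ⊆ ℝ^N be an open connected set, let 0 < r₁ < r₂ be such that the closed ball of radius r₂ centered at 0 is contained in Ω, and let u : Ω → ℝ be lower semicontinuous and a viscosity supersolution of P⁺_k(D²u) = 0 in Ω. Set m(r) = min_{|x| ≤ r} u(x). Then for every r with r₁ ≤ r ≤ r₂: if k = 1, m(r) ≥ [m(r₁)(r₂ − r) + m(r₂)(r − r₁)]/(r₂ − r₁); if k = 2, m(r) ≥ [m(r₁)·log(r₂/r) + m(r₂)·log(r/r₁)]/log(r₂/r₁); if k > 2, m(r) ≥ [m(r₁)(r^{2−k} − r₂^{2−k}) + m(r₂)(r₁^{2−k} − r^{2−k})]/(r₁^{2−k} − r₂^{2−k}).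 -/
open scoped BigOperators

lemma s14_pplus_lower {N k : ℕ} (hk : 0 < k) (hkN : k ≤ N)
    (A : Matrix (Fin N) (Fin N) ℝ) (a b : ℝ) (hb : 0 ≤ b) (x : Fin N → ℝ) (hx : x ≠ 0)
    (hA : A = fun i j => b * (x i * x j) + if i = j then a else 0) :
    (k : ℝ) * a + b * ∑ i, x i ^ 2 ≤ Pplus k A := by
  have hH : A.IsHermitian := by
    ext i j
    rw [Matrix.conjTranspose_apply, star_trivial, hA]
    by_cases h : i = j
    · subst h; rfl
    · simp [h, Ne.symm h, mul_comm (x i)]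
  have hmul : ∀ v : Fin N → ℝ, A.mulVec v = fun i => b * (x i * ∑ j, x j * v j) + a * v i := by
    intro v
    ext i
    simp only [Matrix.mulVec, dotProduct, hA, add_mul, Finset.sum_add_distrib, ite_mul, zero_mul,
      Finset.sum_ite_eq, Finset.mem_univ, if_true, Finset.mul_sum]
    congr 1
    exact Finset.sum_congr rfl fun j _ => by ring
  -- every eigenvalue is at least a
  have hge : ∀ i, a ≤ hH.eigenvalues i := by
    intro i
    have h1 := hH.mulVec_eigenvectorBasis i
    set v : Fin N → ℝ := ⇑(hH.eigenvectorBasis i) with hv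
    have hvn : ∑ j, v j * v j = 1 := by
      have := hH.eigenvectorBasis.orthonormal.1 i
      have h2 : ‖hH.eigenvectorBasis i‖ ^ 2 = 1 := by rw [this]; norm_num
      rw [EuclideanSpace.norm_sq_eq] at h2
      simpa [hv, sq] using h2
    have h3 : ∑ j, v j * (A.mulVec v) j = hH.eigenvalues i := by
      rw [h1]
      have : ∀ j, v j * (hH.eigenvalues i • v) j = hH.eigenvalues i * (v j * v j) := by
        intro j; simp; ring
      rw [Finset.sum_congr rfl fun j _ => this j, ← Finset.mul_sum, hvn, mul_one]
    rw [hmul] at h3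
    have h4 : ∑ j, v j * (b * (x j * ∑ l, x l * v l) + a * v j)
        = b * (∑ l, x l * v l) ^ 2 + a := by
      have : ∀ j, v j * (b * (x j * ∑ l, x l * v l) + a * v j)
        = b * (∑ l, x l * v l) * (x j * v j) + a * (v j * v j) := by intro j; ring
      rw [Finset.sum_congr rfl fun j _ => this j, Finset.sum_add_distrib, ← Finset.mul_sum,
        ← Finset.mul_sum, hvn]
      ring
    rw [h4] at h3
    have := mul_nonneg hb (sq_nonneg (∑ l, x l * v l))
    linarith
  -- the top eigenvalue
  have htop : ∃ i, hH.eigenvalues i = a + b * ∑ i, x i ^ 2 := by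
    have hmem : (a + b * ∑ i, x i ^ 2) ∈ spectrum ℝ A := by
      rw [← Matrix.spectrum_toLin']
      apply Module.End.HasEigenvalue.mem_spectrum
      apply Module.End.hasEigenvalue_of_hasEigenvector (x := x)
      rw [Module.End.hasEigenvector_iff, Module.End.mem_eigenspace_iff]
      refine ⟨?_, hx⟩
      rw [Matrix.toLin'_apply, hmul]
      ext i
      simp only [Pi.smul_apply, smul_eq_mul]
      have : ∑ j, x j * x j = ∑ i, x i ^ 2 := Finset.sum_congr rfl fun j _ => by ring
      rw [this]; ring
    rw [hH.spectrum_real_eq_range_eigenvalues] at hmem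
    exact hmem
  obtain ⟨i₀, hi₀⟩ := htop
  have hN : 0 < N := by omega
  have hse : sortedEig A = hH.eigenvalues ∘ Tuple.sort hH.eigenvalues := by
    rw [sortedEig, dif_pos hH]
  have hge' : ∀ i, a ≤ sortedEig A i := by
    intro i; rw [hse]; exact hge _
  let l : Fin N := ⟨N - 1, by omega⟩
  have hlast : a + b * ∑ i, x i ^ 2 ≤ sortedEig A l := by
    rw [hse]
    have hmono := Tuple.monotone_sort hH.eigenvalues
    have h := @hmono ((Tuple.sort hH.eigenvalues).symm i₀) l (by
      rw [Fin.le_def]; simp only [l]; omega)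
    simp only [Function.comp, Equiv.apply_symm_apply] at h
    rw [hi₀] at h
    exact h
  have hcard : (Finset.univ.filter (fun i : Fin N => N - k ≤ (i : ℕ))).card = k := by
    have : (Finset.univ.filter (fun i : Fin N => N - k ≤ (i : ℕ)))
        = Finset.Ici (⟨N - k, by omega⟩ : Fin N) := by
      ext i; simp [Fin.le_def]
    rw [this, Fin.card_Ici]
    simp; omega
  rw [Pplus, ← Finset.sum_filter]
  have hl : l ∈ Finset.univ.filter (fun i : Fin N => N - k ≤ (i : ℕ)) := by
    simp [l]; omega
  rw [← Finset.add_sum_erase _ _ hl]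
  have h5 := Finset.card_nsmul_le_sum
    ((Finset.univ.filter (fun i : Fin N => N - k ≤ (i : ℕ))).erase l) (sortedEig A) a
    (fun i _ => hge' i)
  rw [Finset.card_erase_of_mem hl, hcard, nsmul_eq_mul, Nat.cast_sub (by omega)] at h5
  push_cast at h5
  linarith

lemma s14_hessian {N : ℕ} (h : ℝ → ℝ) (hh : ContDiff ℝ 2 h) (x : EuclideanSpace ℝ (Fin N)) :
    hessianMatrix (fun y => h (‖y‖ ^ 2)) x = fun i j =>
      (4 * deriv (deriv h) (‖x‖ ^ 2)) * (x i * x j)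
        + if i = j then 2 * deriv h (‖x‖ ^ 2) else 0 := by
  have hd : Differentiable ℝ h := hh.differentiable (by norm_num)
  have hd1 : ContDiff ℝ 1 (deriv h) := by
    have : ContDiff ℝ (1 + 1) h := by simpa [one_add_one_eq_two] using hh
    exact (contDiff_succ_iff_deriv.1 this).2.2
  have hd' : Differentiable ℝ (deriv h) := hd1.differentiable (by norm_num)
  have hn : ∀ y : EuclideanSpace ℝ (Fin N),
      HasFDerivAt (fun y : EuclideanSpace ℝ (Fin N) => ‖y‖ ^ 2) (2 • innerSL ℝ y) y := fun y =>
    (hasStrictFDerivAt_norm_sq y).hasFDerivAt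
  have h1 : fderiv ℝ (fun y : EuclideanSpace ℝ (Fin N) => h (‖y‖ ^ 2))
      = fun y => (deriv h (‖y‖ ^ 2)) • (2 • innerSL ℝ y) := by
    ext1 y
    exact ((hd _).hasDerivAt.comp_hasFDerivAt y (hn y)).fderiv
  have h2 := ((hd' (‖x‖ ^ 2)).hasDerivAt.comp_hasFDerivAt x (hn x)).smul
    (((innerSL ℝ : EuclideanSpace ℝ (Fin N) →L[ℝ] _).hasFDerivAt (x := x)).const_smul (2 : ℕ))
  ext i j
  rw [hessianMatrix, iteratedFDeriv_two_apply, h1]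
  erw [h2.fderiv]
  have hin : ∀ y z : EuclideanSpace ℝ (Fin N), innerSL ℝ y z = inner ℝ y z := fun _ _ => rfl
  simp [EuclideanSpace.inner_single_right, hin]
  by_cases hij : i = j
  · subst hij; simp [hin, EuclideanSpace.inner_single_right]; ring
  · simp [hij, Ne.symm hij, hin, EuclideanSpace.inner_single_right]; ring

lemma s14_super {N k : ℕ} (hk : 0 < k) (hkN : k ≤ N)
    (Ω : Set (EuclideanSpace ℝ (Fin N))) (u : EuclideanSpace ℝ (Fin N) → ℝ)
    (hsuper : IsViscositySupersolution (Pplus k) (fun _ => 0) Ω u)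
    (h : ℝ → ℝ) (hh : ContDiff ℝ 2 h) (x : EuclideanSpace ℝ (Fin N)) (hxΩ : x ∈ Ω) (hx : x ≠ 0)
    (hconv : 0 ≤ deriv (deriv h) (‖x‖ ^ 2))
    (hmin : IsLocalMinOn (fun y => u y - h (‖y‖ ^ 2)) Ω x) :
    2 * k * deriv h (‖x‖ ^ 2) + 4 * ‖x‖ ^ 2 * deriv (deriv h) (‖x‖ ^ 2) ≤ 0 := by
  have h1 := hsuper x hxΩ (fun y => h (‖y‖ ^ 2)) (hh.comp (contDiff_norm_sq ℝ)) hmin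
  have h2 := s14_pplus_lower hk hkN _ _ (4 * deriv (deriv h) (‖x‖ ^ 2)) (by linarith) (⇑x)
    (by intro h0; apply hx; ext i; exact congrFun h0 i) (s14_hessian h hh x)
  have h3 : ‖x‖ ^ 2 = ∑ i, x i ^ 2 := by
    rw [EuclideanSpace.norm_sq_eq]; simp
  rw [← h3] at h2
  linarith

lemma s14_cutoff (g : ℝ → ℝ) (hg : ∀ s, 0 < s → ContDiffAt ℝ 2 g s) (c : ℝ) (hc : 0 < c) :
    ∃ h : ℝ → ℝ, ContDiff ℝ 2 h ∧ ∀ s, c ≤ s → h s = g s := by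
  refine ⟨fun s => Real.smoothTransition (2 * s / c - 1) * g s, ?_, ?_⟩
  · rw [contDiff_iff_contDiffAt]
    intro s
    by_cases hs : 0 < s
    · refine ContDiffAt.mul ?_ (hg s hs)
      exact (Real.smoothTransition.contDiff.comp (by fun_prop :
        ContDiff ℝ 2 fun s : ℝ => 2 * s / c - 1)).contDiffAt
    · have : (fun s => Real.smoothTransition (2 * s / c - 1) * g s) =ᶠ[nhds s] fun _ => 0 := by
        filter_upwards [Iio_mem_nhds (show s < c / 2 by linarith)] with t ht
        rw [Real.smoothTransition.zero_of_nonpos, zero_mul]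
        have ht' : t < c / 2 := ht
        have : 2 * t / c ≤ 1 := by rw [div_le_one hc]; linarith
        linarith
      exact contDiffAt_const.congr_of_eventuallyEq this
  · intro s hs
    have : Real.smoothTransition (2 * s / c - 1) = 1 := by
      apply Real.smoothTransition.one_of_one_le
      have : 2 ≤ 2 * s / c := by rw [le_div_iff₀ hc]; linarith
      linarith
    simp [this]

lemma s14_comparison {N k : ℕ} (hk : 0 < k) (hkN : k ≤ N)
    (Ω : Set (EuclideanSpace ℝ (Fin N))) (hΩ : IsOpen Ω)
    (r₁ r₂ : ℝ) (hr₁ : 0 < r₁) (hr₁₂ : r₁ < r₂)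
    (hball : Metric.closedBall (0 : EuclideanSpace ℝ (Fin N)) r₂ ⊆ Ω)
    (u : EuclideanSpace ℝ (Fin N) → ℝ) (hlsc : LowerSemicontinuousOn u Ω)
    (hsuper : IsViscositySupersolution (Pplus k) (fun _ => 0) Ω u)
    (G : ℝ → ℝ) (hG : ∀ s, 0 < s → ContDiffAt ℝ 2 G s) (c : ℝ) (hc : 0 ≤ c)
    (hG' : ∀ s, 0 < s → HasDerivAt G (-c * s ^ (-(k : ℝ) / 2)) s)
    (h1 : ∀ x : EuclideanSpace ℝ (Fin N), ‖x‖ = r₁ → G (r₁ ^ 2) ≤ u x)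
    (h2 : ∀ x : EuclideanSpace ℝ (Fin N), ‖x‖ = r₂ → G (r₂ ^ 2) ≤ u x) :
    ∀ x : EuclideanSpace ℝ (Fin N), r₁ ≤ ‖x‖ → ‖x‖ ≤ r₂ → G (‖x‖ ^ 2) ≤ u x := by
  have key : ∀ ε : ℝ, 0 < ε → ∀ x : EuclideanSpace ℝ (Fin N), r₁ ≤ ‖x‖ → ‖x‖ ≤ r₂ →
      G (‖x‖ ^ 2) + ε * (‖x‖ ^ 2 - r₂ ^ 2) ≤ u x := by
    intro ε hε x hx1 hx2
    obtain ⟨h, hh, hheq⟩ := s14_cutoff (fun s => G s + ε * (s - r₂ ^ 2))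
      (fun s hs => (hG s hs).add (by fun_prop)) (r₁ ^ 2) (by positivity)
    let K : Set (EuclideanSpace ℝ (Fin N)) := {y | r₁ ≤ ‖y‖} ∩ Metric.closedBall 0 r₂
    have hK : IsCompact K :=
      (isCompact_closedBall _ _).inter_left (isClosed_le continuous_const continuous_norm)
    have hKΩ : K ⊆ Ω := fun y hy => hball hy.2
    have hxK : x ∈ K := ⟨hx1, by simpa using hx2⟩
    have hl : LowerSemicontinuousOn (fun y => u y - h (‖y‖ ^ 2)) K := by
      have hcont : Continuous fun y : EuclideanSpace ℝ (Fin N) => -h (‖y‖ ^ 2) :=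
        (hh.continuous.comp (by fun_prop)).neg
      simpa [sub_eq_add_neg] using
        (hlsc.mono hKΩ).add (hcont.lowerSemicontinuous.lowerSemicontinuousOn K)
    obtain ⟨x₀, hx₀, hmin⟩ := hl.exists_isMinOn ⟨x, hxK⟩ hK
    have hsq : ∀ y : EuclideanSpace ℝ (Fin N), r₁ ≤ ‖y‖ →
        h (‖y‖ ^ 2) = G (‖y‖ ^ 2) + ε * (‖y‖ ^ 2 - r₂ ^ 2) := fun y hy =>
      hheq _ (by gcongr)
    have hmx : u x₀ - h (‖x₀‖ ^ 2) ≤ u x - h (‖x‖ ^ 2) := hmin hxK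
    have hx₀1 : r₁ ≤ ‖x₀‖ := hx₀.1
    have hx₀2 : ‖x₀‖ ≤ r₂ := by simpa using hx₀.2
    rw [hsq x hx1, hsq x₀ hx₀1] at hmx
    by_contra hcon
    have hneg : u x₀ - (G (‖x₀‖ ^ 2) + ε * (‖x₀‖ ^ 2 - r₂ ^ 2)) < 0 := by linarith
    have hsr : ε * (‖x₀‖ ^ 2 - r₂ ^ 2) ≤ 0 := by
      have : ‖x₀‖ ^ 2 ≤ r₂ ^ 2 := by gcongr
      nlinarith
    have hlt1 : r₁ < ‖x₀‖ := by
      refine lt_of_le_of_ne hx₀1 fun he => ?_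
      have := h1 x₀ he.symm
      rw [← he] at hneg hsr
      linarith
    have hlt2 : ‖x₀‖ < r₂ := by
      refine lt_of_le_of_ne hx₀2 fun he => ?_
      have := h2 x₀ he
      rw [he] at hneg hsr
      linarith
    have hloc : IsLocalMinOn (fun y => u y - h (‖y‖ ^ 2)) Ω x₀ := by
      refine IsLocalMin.on ?_ Ω
      have hKn : K ∈ nhds x₀ := by
        have a1 : {y : EuclideanSpace ℝ (Fin N) | r₁ < ‖y‖} ∈ nhds x₀ :=
          (isOpen_lt continuous_const continuous_norm).mem_nhds hlt1
        have a2 : {y : EuclideanSpace ℝ (Fin N) | ‖y‖ < r₂} ∈ nhds x₀ :=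
          (isOpen_lt continuous_norm continuous_const).mem_nhds hlt2
        filter_upwards [a1, a2] with y hy1 hy2
        exact ⟨le_of_lt hy1, by simpa using le_of_lt hy2⟩
      exact hmin.isLocalMin hKn
    have hs0 : r₁ ^ 2 < ‖x₀‖ ^ 2 := by gcongr
    have hpos : 0 < r₁ ^ 2 := by positivity
    have hD : ∀ s, r₁ ^ 2 < s → HasDerivAt h (-c * s ^ (-(k : ℝ) / 2) + ε) s := by
      intro s hs
      have e1 : HasDerivAt (fun s => G s + ε * (s - r₂ ^ 2)) (-c * s ^ (-(k : ℝ) / 2) + ε) s := by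
        have := (hG' s (by linarith)).add (((hasDerivAt_id s).sub_const (r₂ ^ 2)).const_mul ε)
        exact this.congr_deriv (by ring)
      refine e1.congr_of_eventuallyEq ?_
      filter_upwards [Ioi_mem_nhds hs] with t ht
      exact hheq t (le_of_lt ht)
    have hs0' : 0 < ‖x₀‖ ^ 2 := by linarith
    have hDD : HasDerivAt (deriv h)
        (-c * ((-(k : ℝ) / 2) * (‖x₀‖ ^ 2) ^ (-(k : ℝ) / 2 - 1))) (‖x₀‖ ^ 2) := by
      have e1 : HasDerivAt (fun s : ℝ => -c * s ^ (-(k : ℝ) / 2) + ε)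
          (-c * ((-(k : ℝ) / 2) * (‖x₀‖ ^ 2) ^ (-(k : ℝ) / 2 - 1))) (‖x₀‖ ^ 2) :=
        ((Real.hasDerivAt_rpow_const (Or.inl hs0'.ne')).const_mul (-c)).add_const ε
      refine e1.congr_of_eventuallyEq ?_
      filter_upwards [Ioi_mem_nhds hs0] with t ht
      exact (hD t ht).deriv
    have hp : 0 < (‖x₀‖ ^ 2) ^ (-(k : ℝ) / 2 - 1) := Real.rpow_pos_of_pos hs0' _
    have hfin := s14_super hk hkN Ω u hsuper h hh x₀ (hKΩ hx₀)
      (by intro h0; rw [h0, norm_zero] at hlt1; linarith)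
      (by
        rw [hDD.deriv]
        have : 0 ≤ c * ((k : ℝ) / 2 * (‖x₀‖ ^ 2) ^ (-(k : ℝ) / 2 - 1)) := by positivity
        linarith) hloc
    rw [hDD.deriv, (hD _ hs0).deriv] at hfin
    have hpow : (‖x₀‖ ^ 2) ^ (-(k : ℝ) / 2) = ‖x₀‖ ^ 2 * (‖x₀‖ ^ 2) ^ (-(k : ℝ) / 2 - 1) := by
      rw [Real.rpow_sub_one hs0'.ne', mul_div_cancel₀ _ hs0'.ne']
    rw [hpow] at hfin
    have hkpos : (0 : ℝ) < k := by exact_mod_cast hk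
    have : 0 < 2 * (k : ℝ) * ε := by positivity
    linarith
  intro x hx1 hx2
  by_contra! hlt
  have hD : 0 ≤ r₂ ^ 2 - ‖x‖ ^ 2 := by
    have : ‖x‖ ^ 2 ≤ r₂ ^ 2 := by gcongr
    linarith
  have hpos : 0 < r₂ ^ 2 - ‖x‖ ^ 2 + 1 := by linarith
  have := key ((G (‖x‖ ^ 2) - u x) / (r₂ ^ 2 - ‖x‖ ^ 2 + 1)) (by apply div_pos <;> linarith) x hx1 hx2
  have h3 : (G (‖x‖ ^ 2) - u x) / (r₂ ^ 2 - ‖x‖ ^ 2 + 1) * (r₂ ^ 2 - ‖x‖ ^ 2 + 1)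
    = G (‖x‖ ^ 2) - u x := by field_simp
  have h4 : 0 < (G (‖x‖ ^ 2) - u x) / (r₂ ^ 2 - ‖x‖ ^ 2 + 1) := by apply div_pos <;> linarith
  linarith

lemma s14_general {N k : ℕ} (hk : 0 < k) (hkN : k ≤ N)
    (Ω : Set (EuclideanSpace ℝ (Fin N))) (hΩ : IsOpen Ω)
    (r₁ r₂ : ℝ) (hr₁ : 0 < r₁) (hr₁₂ : r₁ < r₂)
    (hball : Metric.closedBall (0 : EuclideanSpace ℝ (Fin N)) r₂ ⊆ Ω)
    (u : EuclideanSpace ℝ (Fin N) → ℝ) (hlsc : LowerSemicontinuousOn u Ω)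
    (hsuper : IsViscositySupersolution (Pplus k) (fun _ => 0) Ω u)
    (m : ℝ → ℝ) (hm : ∀ r : ℝ, m r = sInf (u '' Metric.closedBall 0 r))
    (g : ℝ → ℝ) (hg : ∀ s, 0 < s → ContDiffAt ℝ 2 g s) (c : ℝ) (hc : 0 < c)
    (hg' : ∀ s, 0 < s → HasDerivAt g (-c * s ^ (-(k : ℝ) / 2)) s)
    (r : ℝ) (hr1 : r₁ ≤ r) (hr2 : r ≤ r₂) :
    (m r₁ * (g (r ^ 2) - g (r₂ ^ 2)) + m r₂ * (g (r₁ ^ 2) - g (r ^ 2)))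
      / (g (r₁ ^ 2) - g (r₂ ^ 2)) ≤ m r := by
  have hanti : StrictAntiOn g (Set.Ioi 0) := by
    apply strictAntiOn_of_deriv_neg (convex_Ioi 0)
    · intro s hs; exact (hg' s hs).continuousAt.continuousWithinAt
    · intro s hs
      rw [interior_Ioi] at hs
      rw [(hg' s hs).deriv]
      have := mul_pos hc (Real.rpow_pos_of_pos hs (-(k : ℝ) / 2))
      linarith
  have hd : 0 < g (r₁ ^ 2) - g (r₂ ^ 2) := by
    have := hanti (show (0 : ℝ) < r₁ ^ 2 by positivity)
      (show (0 : ℝ) < r₂ ^ 2 by have := hr₁.trans hr₁₂; positivity) (by gcongr)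
    linarith
  have hbdd : ∀ ρ, ρ ≤ r₂ → BddBelow (u '' Metric.closedBall 0 ρ) := by
    intro ρ hρ
    have : BddBelow (u '' Metric.closedBall 0 r₂) := by
      obtain ⟨x₀, -, hmin⟩ := (hlsc.mono hball).exists_isMinOn
        ⟨0, by simp; linarith⟩ (isCompact_closedBall _ _)
      refine ⟨u x₀, ?_⟩
      rintro _ ⟨y, hy, rfl⟩
      exact hmin hy
    exact this.mono (Set.image_mono (Metric.closedBall_subset_closedBall hρ))
  have hmle : ∀ ρ, ρ ≤ r₂ → ∀ x : EuclideanSpace ℝ (Fin N), ‖x‖ ≤ ρ → m ρ ≤ u x := by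
    intro ρ hρ x hx
    rw [hm]
    exact csInf_le (hbdd ρ hρ) ⟨x, by simpa using hx, rfl⟩
  have hlem : ∀ ρ, 0 ≤ ρ → ∀ t, (∀ x : EuclideanSpace ℝ (Fin N), ‖x‖ ≤ ρ → t ≤ u x) → t ≤ m ρ := by
    intro ρ hρ t ht
    rw [hm]
    refine le_csInf ⟨u 0, 0, by simpa using hρ, rfl⟩ ?_
    rintro _ ⟨y, hy, rfl⟩
    exact ht y (by simpa using hy)
  have hm12 : m r₂ ≤ m r₁ :=
    hlem r₁ hr₁.le _ fun x hx => hmle r₂ le_rfl x (hx.trans hr₁₂.le)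
  set D := g (r₁ ^ 2) - g (r₂ ^ 2) with hD
  let B := (m r₁ - m r₂) / D
  have hB : 0 ≤ B := div_nonneg (by linarith) hd.le
  have hBD : B * D = m r₁ - m r₂ := div_mul_cancel₀ _ hd.ne'
  let G : ℝ → ℝ := fun s => B * (g s - g (r₂ ^ 2)) + m r₂
  have hG1 : G (r₁ ^ 2) = m r₁ := by simp only [G]; rw [← hD, hBD]; ring
  have hG2 : G (r₂ ^ 2) = m r₂ := by simp [G]
  have hcomp := s14_comparison hk hkN Ω hΩ r₁ r₂ hr₁ hr₁₂ hball u hlsc hsuper G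
    (fun s hs => (contDiffAt_const.mul ((hg s hs).sub contDiffAt_const)).add contDiffAt_const)
    (B * c) (by positivity)
    (fun s hs => by
      have := (((hg' s hs).sub_const (g (r₂ ^ 2))).const_mul B).add_const (m r₂)
      exact this.congr_deriv (by ring))
    (fun x hx => by rw [hG1]; exact hmle r₁ hr₁₂.le x hx.le)
    (fun x hx => by rw [hG2]; exact hmle r₂ le_rfl x hx.le)
  have hGanti : ∀ s t, 0 < s → s ≤ t → G t ≤ G s := by
    intro s t hs hst
    have := hanti.antitoneOn (show s ∈ Set.Ioi 0 from hs) (show t ∈ Set.Ioi 0 from hs.trans_le hst) hst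
    simp only [G]
    gcongr
  have hrew : (m r₁ * (g (r ^ 2) - g (r₂ ^ 2)) + m r₂ * (g (r₁ ^ 2) - g (r ^ 2))) / D = G (r ^ 2) := by
    simp only [G, B]
    rw [div_eq_iff hd.ne']
    field_simp
    rw [hD]; ring
  rw [hrew]
  refine hlem r (by linarith) _ fun x hx => ?_
  rcases le_total ‖x‖ r₁ with h | h
  · calc G (r ^ 2) ≤ G (r₁ ^ 2) := hGanti _ _ (by positivity) (by gcongr)
      _ = m r₁ := hG1
      _ ≤ u x := hmle r₁ hr₁₂.le x h
  · exact (hGanti _ _ (by have := hr₁.trans_le h; positivity) (by gcongr)).trans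
      (hcomp x h (hx.trans hr2))

theorem statement14 (N k : ℕ) (hk : 0 < k) (hkN : k ≤ N)
    (Ω : Set (EuclideanSpace ℝ (Fin N))) (hΩ : IsOpen Ω) (hconn : IsConnected Ω)
    (r₁ r₂ : ℝ) (hr₁ : 0 < r₁) (hr₁₂ : r₁ < r₂)
    (hball : Metric.closedBall (0 : EuclideanSpace ℝ (Fin N)) r₂ ⊆ Ω)
    (u : EuclideanSpace ℝ (Fin N) → ℝ) (hlsc : LowerSemicontinuousOn u Ω)
    (hsuper : IsViscositySupersolution (Pplus k) (fun _ => 0) Ω u)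
    (m : ℝ → ℝ) (hm : ∀ r : ℝ, m r = sInf (u '' Metric.closedBall 0 r)) :
    ∀ r : ℝ, r₁ ≤ r → r ≤ r₂ →
      (k = 1 → (m r₁ * (r₂ - r) + m r₂ * (r - r₁)) / (r₂ - r₁) ≤ m r) ∧
      (k = 2 →
        (m r₁ * Real.log (r₂ / r) + m r₂ * Real.log (r / r₁)) / Real.log (r₂ / r₁) ≤ m r) ∧
      (2 < k →
        (m r₁ * (r ^ ((2 : ℝ) - (k : ℝ)) - r₂ ^ ((2 : ℝ) - (k : ℝ)))
          + m r₂ * (r₁ ^ ((2 : ℝ) - (k : ℝ)) - r ^ ((2 : ℝ) - (k : ℝ))))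
          / (r₁ ^ ((2 : ℝ) - (k : ℝ)) - r₂ ^ ((2 : ℝ) - (k : ℝ))) ≤ m r) := by
  intro r hr1 hr2
  have hr : 0 < r := hr₁.trans_le hr1
  have hr₂ : 0 < r₂ := hr₁.trans hr₁₂
  have main := s14_general hk hkN Ω hΩ r₁ r₂ hr₁ hr₁₂ hball u hlsc hsuper m hm
  refine ⟨fun h => ?_, fun h => ?_, fun h => ?_⟩
  · subst h
    have := main (fun s => -Real.sqrt s) (fun s hs => (Real.contDiffAt_sqrt hs.ne').neg)
      (1 / 2) (by norm_num) (fun s hs => by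
        have := (Real.hasDerivAt_sqrt hs.ne').neg
        refine this.congr_deriv ?_
        rw [Real.sqrt_eq_rpow]
        norm_num
        rw [Real.rpow_neg hs.le]
        ring) r hr1 hr2
    simp only [Real.sqrt_sq hr.le, Real.sqrt_sq hr₁.le, Real.sqrt_sq hr₂.le] at this
    convert this using 2 <;> ring
  · subst h
    have := main (fun s => -Real.log s) (fun s hs => (Real.contDiffAt_log.2 hs.ne').neg)
      1 (by norm_num) (fun s hs => by
        have := (Real.hasDerivAt_log hs.ne').neg
        refine this.congr_deriv ?_
        norm_num
        rw [Real.rpow_neg_one]) r hr1 hr2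
    simp only [Real.log_pow] at this
    rw [Real.log_div hr₂.ne' hr.ne', Real.log_div hr.ne' hr₁.ne', Real.log_div hr₂.ne' hr₁.ne']
    have hl : Real.log r₁ < Real.log r₂ := Real.log_lt_log hr₁ hr₁₂
    rw [div_le_iff₀ (by push_cast; linarith)] at this
    rw [div_le_iff₀ (by linarith)]
    push_cast at this
    linarith
  · have hk2 : (2 : ℝ) < k := by exact_mod_cast h
    have := main (fun s => s ^ ((2 - (k : ℝ)) / 2))
      (fun s hs => Real.contDiffAt_rpow_const_of_ne hs.ne')
      (((k : ℝ) - 2) / 2) (by linarith) (fun s hs => by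
        have := Real.hasDerivAt_rpow_const (p := (2 - (k : ℝ)) / 2) (Or.inl hs.ne')
        convert this using 1
        rw [show (2 - (k : ℝ)) / 2 - 1 = -(k : ℝ) / 2 by ring]
        ring) r hr1 hr2
    have e : ∀ ρ : ℝ, 0 < ρ → (ρ ^ 2) ^ ((2 - (k : ℝ)) / 2) = ρ ^ (2 - (k : ℝ)) := by
      intro ρ hρ
      rw [← Real.rpow_natCast ρ 2, ← Real.rpow_mul hρ.le]
      congr 1
      push_cast
      ring
    simp only [e r hr, e r₁ hr₁, e r₂ hr₂] at this
    exact this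
end

section
/- Let N be a positive integer and k ∈ {1, 2} with k ≤ N. Let u : ℝ^N → ℝ be lower semicontinuous and a viscosity supersolution of P⁺_k(D²u) = 0 in ℝ^N, and set m(r) = min_{|x| ≤ r} u(x). Assume that limsup_{r→+∞} m(r)/r ≥ 0 if k = 1, and that limsup_{r→+∞} m(r)/log r ≥ 0 if k = 2. Then u is constant. -/
open scoped BigOperators

lemma kyfan_s15 {N k : ℕ} (hk : 0 < k) (hkN : k ≤ N) (A : Matrix (Fin N) (Fin N) ℝ) (hA : A.IsHermitian)
    (b : OrthonormalBasis (Fin N) ℝ (EuclideanSpace ℝ (Fin N))) :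
    (∑ j : Fin N, if (j:ℕ) < k then inner ℝ (b j) (Matrix.toEuclideanLin A (b j)) else 0) ≤ Pplus k A := by
  set σ := Tuple.sort hA.eigenvalues with hσ
  set e := hA.eigenvectorBasis.reindex σ.symm with he
  have hs : sortedEig A = fun i => hA.eigenvalues (σ i) := by
    unfold sortedEig; rw [dif_pos hA]; rfl
  have hmono : Monotone (sortedEig A) := by
    rw [hs]; exact Tuple.monotone_sort hA.eigenvalues
  have hev : ∀ i, Matrix.toEuclideanLin A (e i) = sortedEig A i • e i := by
    intro i
    rw [hs, he]
    simp only [OrthonormalBasis.reindex_apply, Equiv.symm_symm]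
    rw [Matrix.toLpLin_apply]
    ext j
    have := congrFun (hA.mulVec_eigenvectorBasis (σ i)) j
    simpa using this
  have hsym : ∀ v w, inner ℝ v (Matrix.toEuclideanLin A w) = inner ℝ (Matrix.toEuclideanLin A v) w :=
    fun v w => ((Matrix.isSymmetric_toEuclideanLin_iff.2 hA) v w).symm
  have hq : ∀ v, inner ℝ v (Matrix.toEuclideanLin A v) = ∑ i, sortedEig A i * (inner ℝ (e i) v)^2 := by
    intro v
    rw [← e.sum_inner_mul_inner v]
    refine Finset.sum_congr rfl fun i _ => ?_
    rw [hsym, hev, inner_smul_left, real_inner_comm]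
    simp; ring
  set c : Fin N → ℝ := fun i => ∑ j : Fin N, if (j:ℕ) < k then (inner ℝ (e i) (b j))^2 else 0 with hc
  have h1 : (∑ j : Fin N, if (j:ℕ) < k then inner ℝ (b j) (Matrix.toEuclideanLin A (b j)) else 0)
      = ∑ i, sortedEig A i * c i := by
    simp only [hc, Finset.mul_sum]
    rw [Finset.sum_comm]
    refine Finset.sum_congr rfl fun j _ => ?_
    rw [hq]
    split_ifs <;> simp
  have hc0 : ∀ i, 0 ≤ c i := fun i => Finset.sum_nonneg fun j _ => by split_ifs <;> positivity
  have hc1 : ∀ i, c i ≤ 1 := by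
    intro i
    have := b.sum_sq_norm_inner_left (e i)
    simp at this
    rw [← this]
    refine Finset.sum_le_sum fun j _ => by
      split_ifs
      · exact le_rfl
      · positivity
  have hcard1 : (∑ j : Fin N, if (j:ℕ) < k then (1:ℝ) else 0) = k := by
    rw [Fin.sum_univ_eq_sum_range (fun j => if j < k then (1:ℝ) else 0) N, ← Finset.sum_filter]
    have : (Finset.range N).filter (· < k) = Finset.range k := by
      ext; simp; omega
    rw [this]; simp
  have hcard2 : (∑ j : Fin N, if N - k ≤ (j:ℕ) then (1:ℝ) else 0) = k := by
    rw [Fin.sum_univ_eq_sum_range (fun j => if N - k ≤ j then (1:ℝ) else 0) N, ← Finset.sum_filter]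
    have : (Finset.range N).filter (N - k ≤ ·) = Finset.Ico (N-k) N := by
      ext; simp; omega
    rw [this]; simp [Nat.cast_sub hkN]
  have hcs : ∑ i, c i = k := by
    simp only [hc]
    rw [Finset.sum_comm, ← hcard1]
    refine Finset.sum_congr rfl fun j _ => ?_
    have := e.sum_sq_norm_inner_right (b j)
    simp at this
    split_ifs
    · exact this
    · simp
  rw [h1, Pplus, ← sub_nonneg, ← Finset.sum_sub_distrib]
  set L := sortedEig A ⟨N - k, by omega⟩ with hL
  have key : 0 ≤ ∑ i : Fin N, (sortedEig A i - L) * ((if N - k ≤ (i:ℕ) then (1:ℝ) else 0) - c i) := by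
    refine Finset.sum_nonneg fun i _ => ?_
    split_ifs with hi
    · exact mul_nonneg (sub_nonneg.2 (hmono (by exact hi))) (sub_nonneg.2 (hc1 i))
    · have : sortedEig A i ≤ L := hmono (by show (i:ℕ) ≤ N - k; omega)
      nlinarith [hc0 i]
  have e2 : ∑ i : Fin N, L * ((if N - k ≤ (i:ℕ) then (1:ℝ) else 0) - c i) = 0 := by
    rw [← Finset.mul_sum, Finset.sum_sub_distrib, hcard2, hcs]; simp
  refine (add_nonneg key e2.ge).trans_eq ?_
  rw [← Finset.sum_add_distrib]
  refine Finset.sum_congr rfl fun i _ => ?_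
  split_ifs <;> ring

lemma hess {N : ℕ} (G G1 G2 : ℝ → ℝ) (x0 : EuclideanSpace ℝ (Fin N))
    (d1 : ∀ s, 0 ≤ s → HasDerivAt G (G1 s) s) (d2 : ∀ s, 0 ≤ s → HasDerivAt G1 (G2 s) s)
    (x : EuclideanSpace ℝ (Fin N)) :
    hessianMatrix (fun z => G (‖z - x0‖^2)) x =
      (2 * G1 (‖x - x0‖^2)) • (1 : Matrix (Fin N) (Fin N) ℝ) +
      (4 * G2 (‖x - x0‖^2)) • Matrix.vecMulVec (fun i => (x - x0) i) (fun i => (x - x0) i) := by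
  have hn : ∀ z : EuclideanSpace ℝ (Fin N), HasFDerivAt (fun z => ‖z - x0‖^2) (2 • innerSL ℝ (z - x0)) z := by
    intro z
    have := ((hasFDerivAt_id z).sub_const x0).norm_sq
    simpa using this
  have hf : fderiv ℝ (fun z => G (‖z - x0‖^2)) = fun z => (2 * G1 (‖z - x0‖^2)) • innerSL ℝ (z - x0) := by
    funext z
    have := ((d1 _ (sq_nonneg ‖z - x0‖)).comp_hasFDerivAt z (hn z)).fderiv
    erw [this]
    ext w; simp; ring
  have hi : HasFDerivAt (fun z : EuclideanSpace ℝ (Fin N) => innerSL ℝ (z - x0)) (innerSL ℝ) x := by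
    have := (innerSL ℝ (E := EuclideanSpace ℝ (Fin N))).hasFDerivAt.comp x ((hasFDerivAt_id x).sub_const x0)
    exact this
  have hs := ((d2 _ (sq_nonneg ‖x - x0‖)).comp_hasFDerivAt x (hn x)).const_mul 2
  have hff := (hs.smul hi).fderiv
  ext i j
  unfold hessianMatrix
  rw [iteratedFDeriv_two_apply, hf]
  erw [hff]
  simp [Matrix.vecMulVec, Matrix.one_apply, EuclideanSpace.inner_single_right]
  have hij : (innerSL ℝ) (EuclideanSpace.single i (1:ℝ)) (EuclideanSpace.single j (1:ℝ))
      = if i = j then 1 else 0 := by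
    rw [innerSL_apply_apply, EuclideanSpace.inner_single_right]
    simp [eq_comm]
  rw [hij]
  split_ifs <;> ring

lemma compare {N k : ℕ} (u : EuclideanSpace ℝ (Fin N) → ℝ) (hlsc : LowerSemicontinuous u)
    (hsuper : IsViscositySupersolution (Pplus k) (fun _ => 0) Set.univ u)
    (x0 : EuclideanSpace ℝ (Fin N)) (ρ R : ℝ) (φ : EuclideanSpace ℝ (Fin N) → ℝ)
    (hφ : ContDiff ℝ 2 φ)
    (hP : ∀ x, ρ < ‖x - x0‖ → ‖x - x0‖ < R → 0 < Pplus k (hessianMatrix φ x))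
    (hb1 : ∀ x, ‖x - x0‖ = ρ → φ x ≤ u x) (hb2 : ∀ x, ‖x - x0‖ = R → φ x ≤ u x)
    (x : EuclideanSpace ℝ (Fin N)) (hx1 : ρ ≤ ‖x - x0‖) (hx2 : ‖x - x0‖ ≤ R) : φ x ≤ u x := by
  set S : Set (EuclideanSpace ℝ (Fin N)) := {y | ρ ≤ ‖y - x0‖ ∧ ‖y - x0‖ ≤ R} with hS
  have hcn : Continuous fun y : EuclideanSpace ℝ (Fin N) => ‖y - x0‖ := by fun_prop
  have hcl : IsClosed S :=
    (isClosed_le continuous_const hcn).inter (isClosed_le hcn continuous_const)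
  have hcomp : IsCompact S := by
    refine (isCompact_closedBall x0 R).of_isClosed_subset hcl fun y hy => ?_
    rw [mem_closedBall_iff_norm]; exact hy.2
  have hl : LowerSemicontinuous fun y => u y - φ y := by
    have := hlsc.add (hφ.continuous.neg.lowerSemicontinuous)
    simpa [sub_eq_add_neg] using this
  have hxS : x ∈ S := ⟨hx1, hx2⟩
  obtain ⟨z, hzS, hz⟩ := LowerSemicontinuousOn.exists_isMinOn ⟨x, hxS⟩ hcomp (hl.lowerSemicontinuousOn S)
  have hzx : u z - φ z ≤ u x - φ x := hz hxS
  suffices 0 ≤ u z - φ z by linarith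
  rcases hzS.1.eq_or_lt with h | h
  · linarith [hb1 z h.symm]
  rcases hzS.2.eq_or_lt with h' | h'
  · linarith [hb2 z h']
  exfalso
  have hnb : S ∈ nhds z := by
    have h1 : ∀ᶠ y in nhds z, ρ < ‖y - x0‖ :=
      (isOpen_lt continuous_const (by fun_prop)).mem_nhds h
    have h2 : ∀ᶠ y in nhds z, ‖y - x0‖ < R :=
      (isOpen_lt (by fun_prop) continuous_const).mem_nhds h'
    filter_upwards [h1, h2] with y a b using ⟨a.le, b.le⟩
  have hloc : IsLocalMinOn (fun y => u y - φ y) Set.univ z :=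
    (hz.isLocalMin hnb).on _
  have := hsuper z trivial φ hφ hloc
  linarith [hP z h h']

lemma pplus_lower {N k : ℕ} (hk : 0 < k) (hkN : k ≤ N) (a c : ℝ) (y : EuclideanSpace ℝ (Fin N))
    (hy : y ≠ 0) :
    k * a + c * ‖y‖^2 ≤ Pplus k (a • (1 : Matrix (Fin N) (Fin N) ℝ) +
      c • Matrix.vecMulVec (fun i => y i) (fun i => y i)) := by
  set A := a • (1 : Matrix (Fin N) (Fin N) ℝ) +
      c • Matrix.vecMulVec (fun i => y i) (fun i => y i) with hAdef
  have hA : A.IsHermitian := by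
    ext i j
    simp [hAdef, Matrix.vecMulVec, Matrix.one_apply, eq_comm, mul_comm]
  have hyn : ‖y‖ ≠ 0 := norm_ne_zero_iff.2 hy
  let i0 : Fin N := ⟨0, by omega⟩
  obtain ⟨b, hb⟩ := Orthonormal.exists_orthonormalBasis_extension_of_card_eq (𝕜 := ℝ)
    (E := EuclideanSpace ℝ (Fin N)) (ι := Fin N) (by simp)
    (v := fun _ => ‖y‖⁻¹ • y) (s := {i0}) (by
      constructor
      · intro i; simp [norm_smul, hyn]
      · intro i j hij; exact absurd (Subsingleton.elim i j) hij)
  have hb0 := hb i0 rfl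
  have hT : ∀ v, inner ℝ v (Matrix.toEuclideanLin A v) = a * ‖v‖^2 + c * (inner ℝ v y)^2 := by
    intro v
    have : Matrix.toEuclideanLin A v = a • v + (c * inner ℝ v y) • y := by
      rw [Matrix.toLpLin_apply]
      ext i
      simp [hAdef, Matrix.add_mulVec, Matrix.smul_mulVec, Matrix.vecMulVec_mulVec]
      have hd : (fun i => y.ofLp i) ⬝ᵥ v.ofLp = inner ℝ v y := by
        simp [dotProduct, PiLp.inner_apply]
      rw [hd]; ring
    rw [this, inner_add_right, inner_smul_right, inner_smul_right, real_inner_self_eq_norm_sq]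
    ring
  have hyb : ∀ j, inner ℝ (b j) y = if j = i0 then ‖y‖ else 0 := by
    intro j
    have : y = ‖y‖ • b i0 := by rw [hb0, smul_smul, mul_inv_cancel₀ hyn, one_smul]
    rw [this, inner_smul_right, b.inner_eq_ite]
    split_ifs <;> simp [norm_smul]
  refine le_trans (le_of_eq ?_) (kyfan_s15 hk hkN A hA b)
  have hcard1 : (∑ j : Fin N, if (j:ℕ) < k then (1:ℝ) else 0) = k := by
    rw [Fin.sum_univ_eq_sum_range (fun j => if j < k then (1:ℝ) else 0) N, ← Finset.sum_filter]
    have : (Finset.range N).filter (· < k) = Finset.range k := by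
      ext; simp; omega
    rw [this]; simp
  have : ∀ j : Fin N, (if (j:ℕ) < k then inner ℝ (b j) (Matrix.toEuclideanLin A (b j)) else 0) =
      (if (j:ℕ) < k then (1:ℝ) else 0) * a + if j = i0 then c * ‖y‖^2 else 0 := by
    intro j
    rw [hT, hyb]
    by_cases hj : j = i0
    · subst hj; simp [i0, hk]
    · simp [hj]
  rw [Finset.sum_congr rfl fun j _ => this j, Finset.sum_add_distrib, ← Finset.sum_mul, hcard1]
  simp

theorem core {N k : ℕ} (hk : 0 < k) (hkN : k ≤ N)
    (u : EuclideanSpace ℝ (Fin N) → ℝ) (hlsc : LowerSemicontinuous u)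
    (hsuper : IsViscositySupersolution (Pplus k) (fun _ => 0) Set.univ u)
    (h h1 h2 : ℝ → ℝ) (hh : ∀ t, 0 < t → ContDiffAt ℝ 2 h t)
    (d1 : ∀ t, 0 < t → HasDerivAt h (h1 t) t) (d2 : ∀ t, 0 < t → HasDerivAt h1 (h2 t) t)
    (hmono : ∀ s t, 0 < s → s ≤ t → h s ≤ h t)
    (heq : ∀ t, 0 < t → 2 * k * h1 t + 4 * t * h2 t = 0)
    (hK : ∀ s, 0 < s → ∃ K, 0 < K ∧ ∀ t, s ≤ t → -h2 t ≤ K)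
    (hgrow : ∀ B, 0 < B → ∀ x0 c ρ, 0 < ρ → ∀ R0, ∃ R, R0 < R ∧
      ∀ x, ‖x - x0‖ = R → c - B * (h (R^2) - h (ρ^2)) ≤ u x) :
    ∃ c : ℝ, ∀ x, u x = c := by
  suffices H : ∀ x0 x1, ∀ ε, 0 < ε → u x0 - 3 * ε ≤ u x1 by
    refine ⟨u 0, fun x => le_antisymm ?_ ?_⟩
    · refine le_of_forall_pos_le_add fun e he => ?_
      linarith [H x 0 (e/3) (by positivity)]
    · refine le_of_forall_pos_le_add fun e he => ?_
      linarith [H 0 x (e/3) (by positivity)]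
  intro x0 x1 ε hε
  have hev := hlsc x0 (u x0 - ε) (by linarith)
  obtain ⟨ρ', hρ', hball⟩ := Metric.eventually_nhds_iff.1 hev
  set ρ := ρ' / 2 with hρdef
  have hρ : 0 < ρ := by positivity
  have hbρ : ∀ x, ‖x - x0‖ ≤ ρ → u x0 - ε ≤ u x := fun x hx =>
    (hball (by rw [dist_eq_norm]; linarith)).le
  rcases le_total ‖x1 - x0‖ ρ with hx | hx
  · linarith [hbρ x1 hx]
  have hρ2 : 0 < ρ^2 := by positivity
  set D := h (‖x1 - x0‖^2 + 1) - h (ρ^2) with hD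
  have hD0 : 0 ≤ D := sub_nonneg.2 (hmono _ _ hρ2 (by nlinarith))
  obtain ⟨B, hB, hBD⟩ : ∃ B, 0 < B ∧ B * D ≤ ε :=
    ⟨ε / (D + 1), by positivity, by rw [div_mul_eq_mul_div, div_le_iff₀ (by positivity)]; nlinarith⟩
  obtain ⟨R, hR, hRb⟩ := hgrow B hB x0 (u x0 - ε) ρ hρ ‖x1 - x0‖
  have hR0 : 0 < R := (norm_nonneg _).trans_lt hR
  set η := ε / R^2 with hη
  have hη0 : 0 < η := by positivity
  have hηR : η * R^2 = ε := by rw [hη]; field_simp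
  obtain ⟨K, hK0, hKb⟩ := hK (ρ^2) hρ2
  obtain ⟨δ, hδ0, hδ1, hδ⟩ : ∃ δ, 0 < δ ∧ δ ≤ 1 ∧ B * (4 * δ * K) < 2 * k * η := by
    have hk' : (0:ℝ) < k := by exact_mod_cast hk
    refine ⟨min 1 (k * η / (4 * B * K)), by positivity, min_le_left _ _, ?_⟩
    have : min 1 (k * η / (4 * B * K)) ≤ k * η / (4 * B * K) := min_le_right _ _
    rw [le_div_iff₀ (by positivity)] at this
    nlinarith [mul_pos hk' hη0]
  set G : ℝ → ℝ := fun s => (u x0 - ε) - B * (h (s + δ) - h (ρ^2)) + η * (s - R^2) with hG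
  have e1 : ∀ s, 0 ≤ s → HasDerivAt G (-(B * h1 (s + δ)) + η) s := by
    intro s hs
    have a1 := (d1 (s + δ) (by linarith)).comp_add_const s δ
    have a2 := (((a1.sub_const (h (ρ^2))).const_mul B).const_sub (u x0 - ε)).add
      (((hasDerivAt_id s).sub_const (R^2)).const_mul η)
    refine a2.congr_deriv ?_
    simp
  have e2 : ∀ s, 0 ≤ s → HasDerivAt (fun s => -(B * h1 (s + δ)) + η) (-(B * h2 (s + δ))) s := by
    intro s hs
    have a1 := (d2 (s + δ) (by linarith)).comp_add_const s δ
    exact ((a1.const_mul B).neg).add_const η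
  have hφ : ContDiff ℝ 2 (fun z => G (‖z - x0‖^2)) := by
    rw [contDiff_iff_contDiffAt]
    intro z
    have n1 : ContDiffAt ℝ 2 (fun z => ‖z - x0‖^2) z := by
      exact ((contDiff_id.sub contDiff_const).norm_sq ℝ).contDiffAt
    have n2 : ContDiffAt ℝ 2 (fun z => h (‖z - x0‖^2 + δ)) z :=
      ContDiffAt.comp z (hh _ (by positivity)) (n1.add contDiffAt_const)
    exact (contDiffAt_const.sub (contDiffAt_const.mul (n2.sub contDiffAt_const))).add
      (contDiffAt_const.mul (n1.sub contDiffAt_const))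
  have hfin := compare u hlsc hsuper x0 ρ R (fun z => G (‖z - x0‖^2)) hφ ?_ ?_ ?_ x1 hx hR.le
  · have m1 : h (‖x1 - x0‖^2 + δ) - h (ρ^2) ≤ D := by
      have := hmono (‖x1 - x0‖^2 + δ) (‖x1 - x0‖^2 + 1) (by positivity) (by linarith)
      linarith
    have m2 := mul_le_mul_of_nonneg_left m1 hB.le
    have m3 : 0 ≤ η * ‖x1 - x0‖^2 := by positivity
    simp only [hG] at hfin
    nlinarith
  · intro x hx1 hx2
    rw [hess G _ _ x0 e1 e2]
    have hne : x - x0 ≠ 0 := norm_pos_iff.1 (hρ.trans hx1)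
    refine lt_of_lt_of_le ?_ (pplus_lower hk hkN _ _ _ hne)
    set s := ‖x - x0‖^2 with hs
    have hsρ : ρ^2 ≤ s := by rw [hs]; gcongr
    have q1 := heq (s + δ) (by linarith)
    have q2 := hKb (s + δ) (by linarith)
    have q3 : B * (4 * δ * (-h2 (s + δ))) ≤ B * (4 * δ * K) := by gcongr
    have q4 : (k:ℝ) * (2 * (-(B * h1 (s + δ)) + η)) + 4 * -(B * h2 (s + δ)) * s
       = 2 * k * η - B * (4 * δ * (-h2 (s+δ))) - B * (2 * k * h1 (s + δ) + 4 * (s + δ) * h2 (s + δ)) := by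
      ring
    rw [q4, q1]; linarith
  · intro x hx
    refine le_trans ?_ (hbρ x hx.le)
    simp only [hG, hx]
    have m1 := hmono (ρ^2) (ρ^2 + δ) hρ2 (by linarith)
    have m2 : 0 ≤ B * (h (ρ^2 + δ) - h (ρ^2)) := mul_nonneg hB.le (by linarith)
    have m3 : ρ^2 ≤ R^2 := by gcongr; linarith
    nlinarith
  · intro x hx
    refine le_trans ?_ (hRb x hx)
    simp only [hG, hx]
    have m1 := hmono (R^2) (R^2 + δ) (by positivity) (by linarith)
    nlinarith

theorem statement15 (N k : ℕ) (hk : 0 < k) (hkN : k ≤ N) (hk12 : k = 1 ∨ k = 2)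
    (u : EuclideanSpace ℝ (Fin N) → ℝ) (hlsc : LowerSemicontinuous u)
    (hsuper : IsViscositySupersolution (Pplus k) (fun _ => 0) Set.univ u)
    (m : ℝ → ℝ) (hm : ∀ r : ℝ, m r = sInf (u '' Metric.closedBall 0 r))
    (h1 : k = 1 →
      0 ≤ Filter.limsup (fun r : ℝ => ((m r / r : ℝ) : EReal)) Filter.atTop)
    (h2 : k = 2 →
      0 ≤ Filter.limsup (fun r : ℝ => ((m r / Real.log r : ℝ) : EReal)) Filter.atTop) :
    ∃ c : ℝ, ∀ x, u x = c := by
  have hle : ∀ r x, ‖x‖ ≤ r → m r ≤ u x := by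
    intro r x hx
    rw [hm]
    refine csInf_le ?_ ⟨x, by simpa using hx, rfl⟩
    exact LowerSemicontinuousOn.bddBelow_of_isCompact (isCompact_closedBall 0 r)
      (hlsc.lowerSemicontinuousOn _)
  have hin : ∀ (x x0 : EuclideanSpace ℝ (Fin N)) (r : ℝ), ‖x - x0‖ = r - ‖x0‖ → ‖x‖ ≤ r := by
    intro x x0 r hx
    have := norm_add_le (x - x0) x0
    rw [sub_add_cancel] at this
    linarith
  have hfreq : ∀ f : ℝ → ℝ, 0 ≤ Filter.limsup (fun r : ℝ => ((f r : ℝ) : EReal)) Filter.atTop →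
      ∀ b : ℝ, b < 0 → ∃ᶠ r in Filter.atTop, b < f r := by
    intro f hf b hb
    have : ((b : ℝ) : EReal) < Filter.limsup (fun r : ℝ => ((f r : ℝ) : EReal)) Filter.atTop :=
      lt_of_lt_of_le (by exact_mod_cast hb) hf
    refine (Filter.frequently_lt_of_lt_limsup (by isBoundedDefault) this).mono fun r hr => ?_
    exact_mod_cast hr
  rcases hk12 with rfl | rfl
  · have hf := hfreq _ (h1 rfl)
    refine core hk hkN u hlsc hsuper Real.sqrt (fun t => 1 / (2 * Real.sqrt t))
      (fun t => -(1 / (4 * t * Real.sqrt t))) ?_ ?_ ?_ ?_ ?_ ?_ ?_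
    · intro t ht; exact Real.contDiffAt_sqrt ht.ne'
    · intro t ht; exact Real.hasDerivAt_sqrt ht.ne'
    · intro t ht
      have hs : 0 < Real.sqrt t := Real.sqrt_pos.2 ht
      have h0 := ((Real.hasDerivAt_sqrt ht.ne').const_mul 2).fun_inv (by positivity)
      have hq := Real.sq_sqrt ht.le
      simp only [one_div]
      refine h0.congr_deriv ?_
      have e : (2 * Real.sqrt t) ^ 2 = 4 * t := by rw [mul_pow, hq]; ring
      rw [e]
      field_simp
    · intro s t _ hst; exact Real.sqrt_le_sqrt hst
    · intro t ht
      have hs : 0 < Real.sqrt t := Real.sqrt_pos.2 ht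
      push_cast
      field_simp
      ring
    · intro s hs
      have hs' : 0 < Real.sqrt s := Real.sqrt_pos.2 hs
      refine ⟨1 / (4 * s * Real.sqrt s), by positivity, fun t ht => ?_⟩
      rw [neg_neg]
      have := Real.sqrt_le_sqrt ht
      have ht0 : 0 < t := hs.trans_le ht
      gcongr
    · intro B hB x0 c ρ hρ R0
      obtain ⟨r, hr, hr0, hr1, hr2⟩ := ((hf (-(B/2)) (by linarith)).and_eventually
        ((Filter.eventually_gt_atTop 0).and ((Filter.eventually_gt_atTop (max R0 0 + ‖x0‖)).and
          (Filter.eventually_gt_atTop ((c + B * (‖x0‖ + ρ)) / (B/2)))))).exists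
      rw [lt_div_iff₀ hr0] at hr
      rw [div_lt_iff₀ (by positivity)] at hr2
      have hR0 : R0 < r - ‖x0‖ := by linarith [le_max_left R0 0]
      have hR1 : 0 < r - ‖x0‖ := by linarith [le_max_right R0 0]
      refine ⟨r - ‖x0‖, hR0, fun x hx => ?_⟩
      rw [Real.sqrt_sq hR1.le, Real.sqrt_sq hρ.le]
      have := hle r x (hin x x0 r hx)
      nlinarith
  · have hf := hfreq _ (h2 rfl)
    refine core hk hkN u hlsc hsuper (fun t => Real.log t / 2) (fun t => t⁻¹ / 2)
      (fun t => -(t ^ 2)⁻¹ / 2) ?_ ?_ ?_ ?_ ?_ ?_ ?_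
    · intro t ht; exact (Real.contDiffAt_log.2 ht.ne').div_const 2
    · intro t ht; exact (Real.hasDerivAt_log ht.ne').div_const 2
    · intro t ht; exact (hasDerivAt_inv ht.ne').div_const 2
    · intro s t hs hst
      have := Real.log_le_log hs hst
      linarith
    · intro t ht
      push_cast
      field_simp
      ring
    · intro s hs
      refine ⟨(s ^ 2)⁻¹ / 2, by positivity, fun t ht => ?_⟩
      rw [neg_div, neg_neg]
      gcongr
    · intro B hB x0 c ρ hρ R0
      obtain ⟨r, hr, hr0, hr1, hr2, hr3⟩ := ((hf (-(B/2)) (by linarith)).and_eventually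
        ((Filter.eventually_gt_atTop 1).and ((Filter.eventually_gt_atTop (max R0 0 + ‖x0‖)).and
          ((Filter.eventually_gt_atTop (2 * ‖x0‖)).and
          (Real.tendsto_log_atTop.eventually
          (Filter.eventually_gt_atTop ((c + B * (Real.log 2 + Real.log ρ)) / (B/2)))))))).exists
      have hl := Real.log_pos hr0
      rw [lt_div_iff₀ hl] at hr
      rw [div_lt_iff₀ (by positivity)] at hr3
      have hR0 : R0 < r - ‖x0‖ := by linarith [le_max_left R0 0]
      have hR1 : 0 < r - ‖x0‖ := by linarith [le_max_right R0 0]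
      refine ⟨r - ‖x0‖, hR0, fun x hx => ?_⟩
      have hlog : Real.log r - Real.log 2 ≤ Real.log (r - ‖x0‖) := by
        rw [← Real.log_div (by linarith) (by norm_num)]
        exact Real.log_le_log (by linarith) (by linarith)
      rw [Real.log_pow, Real.log_pow]
      push_cast
      have := hle r x (hin x x0 r hx)
      nlinarith
end
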